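/- arXiv:math/0105002 — 3 statements merged into one kernel-verified Lean document; each statement's English description precedes it below -/
import Mathlib

section
/- For |q|<1: Σ_{n≥0} q^n/(-q;q^2)_{n+1} = Σ_{n≥0} (-1)^n q^{2n(3n+2)} (1 + q^{4n+2}). -/
open scoped BigOperators

/-- finite q-Pochhammer symbol `(x;q)_n = ∏_{j=0}^{n-1} (1 - x q^j)` -/
noncomputable def qPoch (x q : ℂ) (n : ℕ) : ℂ := ∏ j ∈ Finset.range n, (1 - x * q ^ j)

/-- infinite q-Pochhammer symbol `(x;q)_∞ = ∏_{j≥0} (1 - x q^j)` -/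
noncomputable def qPochInf (x q : ℂ) : ℂ := ∏' j : ℕ, (1 - x * q ^ j)

/-- Gaussian binomial coefficient in base q, zero outside `0 ≤ k ≤ m`. -/
noncomputable def qbinom (q : ℂ) (m k : ℤ) : ℂ :=
  if 0 ≤ k ∧ k ≤ m then
    qPoch q q m.toNat / (qPoch q q k.toNat * qPoch q q (m - k).toNat)
  else 0


lemma tele_aux {w : ℕ → ℂ} (hw : Summable w) : ∑' n, (w n - w (n + 1)) = w 0 := by
  have h1 : Summable (fun n => w (n + 1)) := (summable_nat_add_iff 1).2 hw
  rw [hw.tsum_sub h1, hw.tsum_eq_zero_add]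
  ring

lemma geo_aux {w : ℕ → ℂ} {C r : ℝ} (h0 : 0 ≤ r) (hr : r < 1) (h : ∀ n, ‖w n‖ ≤ C * r ^ n) :
    Summable w :=
  Summable.of_norm_bounded ((summable_geometric_of_lt_one h0 hr).mul_left C) h

lemma geo_bound {w : ℕ → ℂ} {C r : ℝ} (h0 : 0 ≤ r) (hr : r < 1) (h : ∀ n, ‖w n‖ ≤ C * r ^ n) :
    ‖∑' n, w n‖ ≤ C * (1 - r)⁻¹ :=
  tsum_of_norm_bounded ((hasSum_geometric_of_lt_one h0 hr).mul_left C) h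

lemma factor_lt {x p : ℂ} (hx : ‖x‖ < 1) (hp : ‖p‖ < 1) (j : ℕ) : ‖x * p ^ j‖ < 1 := by
  rw [norm_mul, norm_pow]
  have := pow_le_one₀ (n := j) (norm_nonneg p) hp.le
  nlinarith [norm_nonneg x, norm_nonneg p]

lemma one_sub_ne {x : ℂ} (hx : ‖x‖ < 1) : 1 - x ≠ 0 := by
  intro h
  have : x = 1 := (sub_eq_zero.1 h).symm
  rw [this] at hx
  simp at hx

lemma qPoch_ne {x p : ℂ} (hx : ‖x‖ < 1) (hp : ‖p‖ < 1) (n : ℕ) : qPoch x p n ≠ 0 := by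
  unfold qPoch
  exact Finset.prod_ne_zero_iff.2 fun j _ => one_sub_ne (factor_lt hx hp j)

lemma qPoch_succ (x p : ℂ) (n : ℕ) : qPoch x p (n + 1) = qPoch x p n * (1 - x * p ^ n) := by
  simp [qPoch, Finset.prod_range_succ]

lemma qPoch_shift (x p : ℂ) (n : ℕ) : qPoch x p (n + 1) = (1 - x) * qPoch (x * p) p n := by
  unfold qPoch
  rw [Finset.prod_range_succ', mul_comm]
  simp [pow_succ', mul_assoc]

lemma qPoch_bound {p : ℂ} (hp : ‖p‖ < 1) {r : ℝ} (h0 : 0 ≤ r) (hr : r < 1) :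
    ∃ K : ℝ, 0 ≤ K ∧ ∀ x : ℂ, ‖x‖ ≤ r → ∀ n, ‖(qPoch x p n)⁻¹‖ ≤ K := by
  refine ⟨Real.exp (r / (1 - r) * (1 - ‖p‖)⁻¹), (Real.exp_pos _).le, fun x hx n => ?_⟩
  have hc : 0 < 1 - r := by linarith
  have hf : ∀ j, ‖(1 - x * p ^ j)⁻¹‖ ≤ Real.exp (r / (1 - r) * ‖p‖ ^ j) := by
    intro j
    have hpj : ‖p‖ ^ j ≤ 1 := pow_le_one₀ (norm_nonneg p) hp.le
    have hpj0 : 0 ≤ ‖p‖ ^ j := by positivity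
    have h1 : ‖x * p ^ j‖ ≤ r * ‖p‖ ^ j := by
      rw [norm_mul, norm_pow]; gcongr
    have h2 : 1 - r * ‖p‖ ^ j ≤ ‖1 - x * p ^ j‖ := by
      have := norm_sub_norm_le (1 : ℂ) (x * p ^ j)
      rw [norm_one] at this
      linarith
    set y := ‖p‖ ^ j
    have h3 : 0 < 1 - r * y := by nlinarith
    rw [norm_inv]
    calc ‖1 - x * p ^ j‖⁻¹ ≤ (1 - r * y)⁻¹ := by gcongr
      _ ≤ r / (1 - r) * y + 1 := by
        rw [inv_le_iff_one_le_mul₀ h3]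
        have : (r / (1 - r) * y + 1) * (1 - r * y) = 1 + r * r * y * (1 - y) / (1 - r) := by
          field_simp; ring
        rw [this]
        have : 0 ≤ r * r * y * (1 - y) / (1 - r) := by
          have : 0 ≤ 1 - y := by linarith
          positivity
        linarith
      _ ≤ _ := Real.add_one_le_exp _
  unfold qPoch
  rw [← Finset.prod_inv_distrib, norm_prod]
  calc _ ≤ ∏ j ∈ Finset.range n, Real.exp (r / (1 - r) * ‖p‖ ^ j) :=
        Finset.prod_le_prod (fun _ _ => norm_nonneg _) (fun j _ => hf j)
    _ = Real.exp (r / (1 - r) * ∑ j ∈ Finset.range n, ‖p‖ ^ j) := by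
        rw [← Real.exp_sum, Finset.mul_sum]
    _ ≤ _ := by
        have : ∑ j ∈ Finset.range n, ‖p‖ ^ j ≤ (1 - ‖p‖)⁻¹ := by
          rw [← tsum_geometric_of_lt_one (norm_nonneg p) hp]
          exact (summable_geometric_of_lt_one (norm_nonneg p) hp).sum_le_tsum _
            (fun _ _ => by positivity)
        gcongr


noncomputable def gT (p x : ℂ) (n : ℕ) : ℂ := x ^ n / qPoch (-x) p (n + 1)

lemma gT_bound {p : ℂ} (hp : ‖p‖ < 1) {r : ℝ} (h0 : 0 ≤ r) (hr : r < 1) :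
    ∃ K : ℝ, 0 ≤ K ∧ ∀ x : ℂ, ‖x‖ ≤ r → ∀ n, ‖gT p x n‖ ≤ K * r ^ n := by
  obtain ⟨K, hK, h⟩ := qPoch_bound hp h0 hr
  refine ⟨K, hK, fun x hx n => ?_⟩
  have := h (-x) (by simpa using hx) (n + 1)
  rw [gT, div_eq_mul_inv, norm_mul, norm_pow, mul_comm]
  gcongr

lemma gT_rec {p x : ℂ} (hp : ‖p‖ < 1) (hx : ‖x‖ < 1) (n : ℕ) :
    (1 - x ^ 2) * gT p x n + x ^ 2 * p * gT p (x * p) n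
      = (1 + x) * (gT p x n - gT p x (n + 1)) := by
  have hxp : ‖x * p‖ < 1 := by simpa using factor_lt hx hp 1
  have e1 := qPoch_succ (-x) p (n + 1)
  have e2 := qPoch_shift (-x) p (n + 1)
  have n1 := qPoch_ne (x := -x) (by simpa using hx) hp (n + 1)
  have n2 := qPoch_ne (x := -x) (by simpa using hx) hp (n + 1 + 1)
  have n3 := qPoch_ne (x := -(x * p)) (by simpa using hxp) hp (n + 1)
  have n4 := one_sub_ne (x := -x) (by simpa using hx)
  have n5 : 1 - -x * p ^ (n + 1) ≠ 0 :=
    one_sub_ne (factor_lt (x := -x) (by simpa using hx) hp (n + 1))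
  rw [neg_mul x p] at e2
  have e3 : qPoch (-(x * p)) p (n + 1) = qPoch (-x) p (n + 1) * (1 - -x * p ^ (n + 1)) / (1 - -x) := by
    rw [← e1, e2]; field_simp
  simp only [gT]
  rw [e3, e1]
  generalize qPoch (-x) p (n + 1) = A at *
  have n4' : 1 + x ≠ 0 := by simpa using n4
  have n5' : 1 + x * p ^ (n + 1) ≠ 0 := by simpa using n5
  simp only [sub_neg_eq_add, neg_mul]
  field_simp
  ring

lemma g_fun {p x : ℂ} (hp : ‖p‖ < 1) (hx : ‖x‖ < 1) :
    (1 - x ^ 2) * ∑' n, gT p x n = 1 - x ^ 2 * p * ∑' n, gT p (x * p) n := by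
  obtain ⟨K, hK, h⟩ := gT_bound hp (norm_nonneg x) hx
  have hxp : ‖x * p‖ ≤ ‖x‖ := by
    rw [norm_mul]; exact mul_le_of_le_one_right (norm_nonneg x) hp.le
  have s1 := geo_aux (norm_nonneg x) hx (h x le_rfl)
  have s2 := geo_aux (norm_nonneg x) hx (h (x * p) hxp)
  have e : ∑' n, ((1 - x ^ 2) * gT p x n + x ^ 2 * p * gT p (x * p) n)
      = (1 + x) * gT p x 0 := by
    rw [← tele_aux s1, ← tsum_mul_left]
    exact tsum_congr (gT_rec hp hx)
  rw [(s1.mul_left _).tsum_add (s2.mul_left _), tsum_mul_left, tsum_mul_left] at e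
  have n4 : 1 + x ≠ 0 := by simpa using one_sub_ne (x := -x) (by simpa using hx)
  have : (1 + x) * gT p x 0 = 1 := by
    simp [gT, qPoch, n4]
  rw [this] at e
  linear_combination e

lemma pow_orbit_le {x p : ℂ} (hp : ‖p‖ < 1) (N : ℕ) : ‖x * p ^ N‖ ≤ ‖x‖ := by
  rw [norm_mul, norm_pow]
  exact mul_le_of_le_one_right (norm_nonneg x) (pow_le_one₀ (norm_nonneg p) hp.le)

lemma sq_lt {x : ℂ} (hx : ‖x‖ < 1) : ‖x ^ 2‖ < 1 := by
  rw [norm_pow]; exact pow_lt_one₀ (norm_nonneg x) hx two_ne_zero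

lemma step_one {p x : ℂ} (hp : ‖p‖ < 1) (hx : ‖x‖ < 1) :
    ∑' n, gT p x n
      = ∑' N : ℕ, (-1) ^ N * x ^ (2 * N) * p ^ (N ^ 2) / qPoch (x ^ 2) (p ^ 2) (N + 1) := by
  obtain ⟨K, hK, h⟩ := gT_bound hp (norm_nonneg x) hx
  obtain ⟨L, hL, h'⟩ := qPoch_bound (sq_lt hp) (norm_nonneg (x ^ 2)) (sq_lt hx)
  set w : ℕ → ℂ := fun N => (-1) ^ N * x ^ (2 * N) * p ^ (N ^ 2) / qPoch (x ^ 2) (p ^ 2) N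
    * ∑' n, gT p (x * p ^ N) n with hw
  have sw : Summable w := by
    refine geo_aux (C := L * (K * (1 - ‖x‖)⁻¹)) (norm_nonneg (x ^ 2)) (sq_lt hx) fun N => ?_
    have b1 := geo_bound (norm_nonneg x) hx (h (x * p ^ N) (pow_orbit_le hp N))
    have b2 := h' (x ^ 2) le_rfl N
    have b3 : ‖p‖ ^ (N ^ 2) ≤ 1 := pow_le_one₀ (norm_nonneg p) hp.le
    have hx1 : 0 ≤ (1 - ‖x‖)⁻¹ := by
      have : 0 ≤ 1 - ‖x‖ := by linarith
      positivity
    calc ‖w N‖ = ‖x ^ 2‖ ^ N * ‖p‖ ^ (N ^ 2) * ‖(qPoch (x ^ 2) (p ^ 2) N)⁻¹‖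
          * ‖∑' n, gT p (x * p ^ N) n‖ := by
          simp [hw, pow_mul, div_eq_mul_inv]
      _ ≤ ‖x ^ 2‖ ^ N * 1 * L * (K * (1 - ‖x‖)⁻¹) := by gcongr
      _ = _ := by ring
  have e0 : w 0 = ∑' n, gT p x n := by simp [hw, qPoch]
  rw [← e0, ← tele_aux sw]
  refine tsum_congr fun N => ?_
  have hN : ‖x * p ^ N‖ < 1 := factor_lt hx hp N
  have f := g_fun hp hN
  have n1 := qPoch_ne (sq_lt hx) (sq_lt hp) N
  have n2 := one_sub_ne (sq_lt hN)
  have n2' : 1 - x ^ 2 * (p ^ 2) ^ N ≠ 0 := by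
    convert n2 using 2; ring
  simp only [hw]
  rw [qPoch_succ, show x * p ^ (N + 1) = x * p ^ N * p by ring]
  have f2 : ∑' n, gT p (x * p ^ N) n
      = (1 - (x * p ^ N) ^ 2 * p * ∑' n, gT p (x * p ^ N * p) n) / (1 - x ^ 2 * (p ^ 2) ^ N) := by
    rw [eq_div_iff n2', ← f]; ring
  rw [f2]
  generalize qPoch (x ^ 2) (p ^ 2) N = A at *
  generalize ∑' n, gT p (x * p ^ N * p) n = B at *
  rw [div_mul_div_comm, div_mul_eq_mul_div, ← sub_div]
  congr 1
  ring


noncomputable def hT (Q z : ℂ) (n : ℕ) : ℂ :=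
  (-1) ^ n * z ^ (2 * n) * Q ^ (n ^ 2 + n) / qPoch (z * Q) (Q ^ 2) (n + 1)

lemma hT_bound {Q : ℂ} (hQ : ‖Q‖ < 1) :
    ∃ K : ℝ, 0 ≤ K ∧ ∀ z : ℂ, ‖z‖ ≤ 1 → ∀ n, ‖hT Q z n‖ ≤ K * ‖Q‖ ^ n := by
  obtain ⟨K, hK, h⟩ := qPoch_bound (sq_lt hQ) (norm_nonneg Q) hQ
  refine ⟨K, hK, fun z hz n => ?_⟩
  have b1 := h (z * Q) (by rw [norm_mul]; exact mul_le_of_le_one_left (norm_nonneg Q) hz) (n + 1)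
  have b2 : ‖z‖ ^ (2 * n) ≤ 1 := pow_le_one₀ (norm_nonneg z) hz
  have b3 : ‖Q‖ ^ (n ^ 2 + n) ≤ ‖Q‖ ^ n :=
    pow_le_pow_of_le_one (norm_nonneg Q) hQ.le (by omega)
  calc ‖hT Q z n‖ = ‖z‖ ^ (2 * n) * ‖Q‖ ^ (n ^ 2 + n) * ‖(qPoch (z * Q) (Q ^ 2) (n + 1))⁻¹‖ := by
        simp [hT, div_eq_mul_inv]
    _ ≤ 1 * ‖Q‖ ^ n * K := by gcongr
    _ = _ := by ring

lemma hT_rec {Q z : ℂ} (hQ : ‖Q‖ < 1) (hz : ‖z‖ ≤ 1) (n : ℕ) :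
    hT Q z n + z ^ 3 * Q ^ 5 * hT Q (z * Q ^ 2) n
      = hT Q z n * (1 - z ^ 2 * Q ^ (2 * n + 2))
        - hT Q z (n + 1) * (1 - z ^ 2 * Q ^ (2 * (n + 1) + 2)) := by
  have hx : ‖z * Q‖ < 1 := by
    rw [norm_mul]; nlinarith [norm_nonneg z, norm_nonneg Q]
  have hp := sq_lt hQ
  have e1 := qPoch_succ (z * Q) (Q ^ 2) (n + 1)
  have e2 := qPoch_shift (z * Q) (Q ^ 2) (n + 1)
  have n1 := qPoch_ne hx hp (n + 1)
  have n4 := one_sub_ne hx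
  have n5 : 1 - z * Q * (Q ^ 2) ^ (n + 1) ≠ 0 := one_sub_ne (factor_lt hx hp (n + 1))
  have e3 : qPoch (z * Q ^ 2 * Q) (Q ^ 2) (n + 1)
      = qPoch (z * Q) (Q ^ 2) (n + 1) * (1 - z * Q * (Q ^ 2) ^ (n + 1)) / (1 - z * Q) := by
    rw [← e1, e2, show z * Q ^ 2 * Q = z * Q * Q ^ 2 by ring]; field_simp
  simp only [hT]
  rw [e3, e1]
  generalize qPoch (z * Q) (Q ^ 2) (n + 1) = A at *
  rw [show Q ^ ((n + 1) ^ 2 + (n + 1)) = Q ^ (n ^ 2 + n) * (Q ^ n) ^ 2 * Q ^ 2 by ring,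
    show z ^ (2 * (n + 1)) = z ^ (2 * n) * z ^ 2 by ring,
    show (z * Q ^ 2) ^ (2 * n) = z ^ (2 * n) * (Q ^ n) ^ 4 by ring,
    show Q ^ (2 * n + 2) = (Q ^ n) ^ 2 * Q ^ 2 by ring,
    show Q ^ (2 * (n + 1) + 2) = (Q ^ n) ^ 2 * Q ^ 4 by ring]
  rw [show (Q ^ 2) ^ (n + 1) = (Q ^ n) ^ 2 * Q ^ 2 by ring] at *
  generalize Q ^ (n ^ 2 + n) = B at *
  generalize z ^ (2 * n) = C at *
  generalize Q ^ n = y at *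
  rw [pow_succ (-1 : ℂ) n]
  generalize (-1 : ℂ) ^ n = s at *
  generalize hd : 1 - z * Q * (y ^ 2 * Q ^ 2) = d at *
  generalize hc : 1 - z * Q = c at *
  field_simp
  rw [← hd, ← hc]
  ring

lemma h_fun {Q z : ℂ} (hQ : ‖Q‖ < 1) (hz : ‖z‖ ≤ 1) :
    ∑' n, hT Q z n = 1 + z * Q - z ^ 3 * Q ^ 5 * ∑' n, hT Q (z * Q ^ 2) n := by
  obtain ⟨K, hK, h⟩ := hT_bound hQ
  have hz2 : ‖z * Q ^ 2‖ ≤ 1 := (pow_orbit_le hQ 2).trans hz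
  have s1 := geo_aux (norm_nonneg Q) hQ (h z hz)
  have s2 := geo_aux (norm_nonneg Q) hQ (h _ hz2)
  have s3 : Summable (fun n => hT Q z n * (1 - z ^ 2 * Q ^ (2 * n + 2))) := by
    refine geo_aux (C := K * 2) (norm_nonneg Q) hQ fun n => ?_
    have b : ‖1 - z ^ 2 * Q ^ (2 * n + 2)‖ ≤ 2 := by
      refine (norm_sub_le _ _).trans ?_
      have : ‖z ^ 2 * Q ^ (2 * n + 2)‖ ≤ 1 := by
        refine (pow_orbit_le hQ _).trans ?_
        rw [norm_pow]; exact pow_le_one₀ (norm_nonneg z) hz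
      rw [norm_one]; linarith
    rw [norm_mul]
    calc _ ≤ (K * ‖Q‖ ^ n) * 2 := by
          have := h z hz n
          gcongr
      _ = _ := by ring
  have e := tele_aux s3
  rw [← tsum_congr (hT_rec hQ hz), s1.tsum_add (s2.mul_left _), tsum_mul_left] at e
  have hx : ‖z * Q‖ < 1 := by
    rw [norm_mul]; nlinarith [norm_nonneg z, norm_nonneg Q]
  have n4 := one_sub_ne hx
  have : hT Q z 0 * (1 - z ^ 2 * Q ^ (2 * 0 + 2)) = 1 + z * Q := by
    simp [hT, qPoch]
    field_simp
    ring
  rw [this] at e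
  linear_combination e

lemma step_two {Q : ℂ} (hQ : ‖Q‖ < 1) :
    ∑' n, hT Q 1 n = ∑' N : ℕ, (-1) ^ N * Q ^ (3 * N ^ 2 + 2 * N) * (1 + Q ^ (2 * N + 1)) := by
  obtain ⟨K, hK, h⟩ := hT_bound hQ
  have hz : ∀ N : ℕ, ‖Q ^ (2 * N)‖ ≤ 1 := fun N => by
    rw [norm_pow]; exact pow_le_one₀ (norm_nonneg Q) hQ.le
  set w : ℕ → ℂ := fun N => (-1) ^ N * Q ^ (3 * N ^ 2 + 2 * N) * ∑' n, hT Q (Q ^ (2 * N)) n with hw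
  have sw : Summable w := by
    refine geo_aux (C := K * (1 - ‖Q‖)⁻¹) (norm_nonneg Q) hQ fun N => ?_
    have b1 := geo_bound (norm_nonneg Q) hQ (h _ (hz N))
    have b3 : ‖Q‖ ^ (3 * N ^ 2 + 2 * N) ≤ ‖Q‖ ^ N :=
      pow_le_pow_of_le_one (norm_nonneg Q) hQ.le (by omega)
    calc ‖w N‖ = ‖Q‖ ^ (3 * N ^ 2 + 2 * N) * ‖∑' n, hT Q (Q ^ (2 * N)) n‖ := by simp [hw]
      _ ≤ ‖Q‖ ^ N * (K * (1 - ‖Q‖)⁻¹) := by gcongr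
      _ = _ := by ring
  have e0 : w 0 = ∑' n, hT Q 1 n := by simp [hw]
  rw [← e0, ← tele_aux sw]
  refine tsum_congr fun N => ?_
  simp only [hw]
  rw [h_fun hQ (hz N), show Q ^ (2 * (N + 1)) = Q ^ (2 * N) * Q ^ 2 by ring]
  ring

theorem stmt_16 (q : ℂ) (hq : ‖q‖ < 1) :
    ∑' n : ℕ, q ^ n / qPoch (-q) (q ^ 2) (n + 1)
      = ∑' n : ℕ, (-1 : ℂ) ^ n * q ^ (2 * n * (3 * n + 2)) * (1 + q ^ (4 * n + 2)) := by
  have h1 := step_one (sq_lt hq) hq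
  have h2 := step_two (sq_lt hq)
  simp only [gT] at h1
  rw [h1]
  calc _ = ∑' n, hT (q ^ 2) 1 n := by
        refine tsum_congr fun n => ?_
        simp only [hT, one_pow, one_mul, mul_one]
        congr 1
        ring
    _ = _ := by
        rw [h2]
        refine tsum_congr fun n => ?_
        ring
end

section
/- Inverse pair: for arbitrary sequences (f_m), (g_r) of elements of a commutative ring containing q with the needed denominators invertible, if g_r = Σ_{l=0}^{⌊r/2⌋} (-1)^l q^{l(3l-2r+1)/2} C[r-l, l]_q f_{r-2l} for all r ≥ 0, then f_m = (q;q)_m Σ_{j=0}^{⌊m/2⌋} (1 - q^{m-2j+1}) q^{j(j-m+1)} g_{m-2j} / ((q;q)_j (q;q)_{m-j+1}) for all m ≥ 0, and conversely. -/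
open scoped BigOperators

/-- Gaussian binomials by the q-Pascal recursion. -/
noncomputable def gaussG (Q : ℂ) : ℕ → ℕ → ℂ
  | _, 0 => 1
  | 0, _ + 1 => 0
  | n + 1, l + 1 => gaussG Q n (l + 1) + Q ^ (n - l) * gaussG Q n l

lemma gaussG_zero (Q : ℂ) (n : ℕ) : gaussG Q n 0 = 1 := by
  cases n <;> simp [gaussG]

lemma gaussG_succ (Q : ℂ) (n l : ℕ) :
    gaussG Q (n + 1) (l + 1) = gaussG Q n (l + 1) + Q ^ (n - l) * gaussG Q n l := by
  simp [gaussG]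

lemma gaussG_gt (Q : ℂ) (n : ℕ) : ∀ l, n < l → gaussG Q n l = 0 := by
  induction n with
  | zero =>
    intro l hl
    obtain ⟨k, rfl⟩ : ∃ k, l = k + 1 := ⟨l - 1, by omega⟩
    simp [gaussG]
  | succ n ih =>
    intro l hl
    obtain ⟨k, rfl⟩ : ∃ k, l = k + 1 := ⟨l - 1, by omega⟩
    rw [gaussG_succ, ih _ (by omega), ih _ (by omega)]
    simp

lemma qP_succ (Q : ℂ) (n : ℕ) : qPoch Q Q (n + 1) = qPoch Q Q n * (1 - Q ^ (n + 1)) := by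
  unfold qPoch
  rw [Finset.prod_range_succ, pow_succ']

lemma qP_zero (Q : ℂ) : qPoch Q Q 0 = 1 := by simp [qPoch]

lemma gaussG_mul (Q : ℂ) (n : ℕ) : ∀ l k, l + k = n →
    gaussG Q n l * (qPoch Q Q l * qPoch Q Q k) = qPoch Q Q n := by
  induction n with
  | zero =>
    intro l k h
    obtain ⟨rfl, rfl⟩ : l = 0 ∧ k = 0 := by omega
    simp [gaussG_zero, qP_zero]
  | succ n ih =>
    intro l k h
    rcases l with _ | l
    · obtain rfl : k = n + 1 := by omega
      simp [gaussG_zero, qP_zero]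
    · rw [gaussG_succ]
      rcases k with _ | k
      · obtain rfl : l = n := by omega
        have h1 := ih l 0 (by omega)
        rw [gaussG_gt Q l (l + 1) (by omega), qP_succ, Nat.sub_self]
        linear_combination (1 - Q ^ (l + 1)) * h1
      · have h1 := ih (l + 1) k (by omega)
        have h2 := ih l (k + 1) (by omega)
        have e : n - l = k + 1 := by omega
        have e2 : n + 1 = (l + 1) + (k + 1) := by omega
        rw [e, qP_succ Q n]
        calc _ = (gaussG Q n (l + 1) * (qPoch Q Q (l + 1) * qPoch Q Q k)) * (1 - Q ^ (k + 1))
              + Q ^ (k + 1) * (1 - Q ^ (l + 1)) *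
                (gaussG Q n l * (qPoch Q Q l * qPoch Q Q (k + 1))) := by
              rw [qP_succ Q k, qP_succ Q l]; ring
          _ = _ := by rw [h1, h2, e2, pow_add]; ring

lemma pascal_sum (Q : ℂ) (n : ℕ) (F : ℕ → ℂ) :
    ∑ l ∈ Finset.range (n + 2), (-1 : ℂ) ^ l * Q ^ (l.choose 2) * gaussG Q (n + 1) l * F l
    = ∑ l ∈ Finset.range (n + 1), (-1 : ℂ) ^ l * Q ^ (l.choose 2) * gaussG Q n l *
        (F l - Q ^ n * F (l + 1)) := by
  have h1 : ∑ l ∈ Finset.range (n + 1), (-1 : ℂ) ^ l * Q ^ (l.choose 2) * gaussG Q n l * F l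
      = ∑ l ∈ Finset.range (n + 2), (-1 : ℂ) ^ l * Q ^ (l.choose 2) * gaussG Q n l * F l := by
    rw [Finset.sum_range_succ _ (n + 1), gaussG_gt Q n (n + 1) (by omega)]
    simp
  simp only [mul_sub]
  rw [Finset.sum_sub_distrib, h1, Finset.sum_range_succ' _ (n + 1),
    Finset.sum_range_succ' _ (n + 1)]
  simp only [gaussG_zero]
  rw [add_sub_right_comm, ← Finset.sum_sub_distrib]
  congr 1
  apply Finset.sum_congr rfl
  intro l hl
  have hl' : l ≤ n := by simp at hl; omega
  obtain ⟨k, rfl⟩ := Nat.exists_eq_add_of_le hl'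
  rw [gaussG_succ, Nat.choose_succ_succ' l 1, Nat.choose_one_right]
  simp only [Nat.add_sub_cancel_left]
  ring

lemma S_zero (Q P : ℂ) (hQP : Q * P = 1) (n : ℕ) : ∀ x : ℂ,
    ∑ l ∈ Finset.range (n + 2), (-1 : ℂ) ^ l * Q ^ (l.choose 2) * gaussG Q (n + 1) l *
      ∏ i ∈ Finset.range n, (1 - x * P ^ (l + i)) = 0 := by
  induction n with
  | zero => intro x; simp [Finset.sum_range_succ, gaussG]
  | succ n ih =>
    intro x
    rw [pascal_sum Q (n + 1) (fun l => ∏ i ∈ Finset.range (n + 1), (1 - x * P ^ (l + i)))]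
    have key := ih (x * P)
    calc _ = ∑ l ∈ Finset.range (n + 2), (1 - Q ^ (n + 1)) * 
            ((-1 : ℂ) ^ l * Q ^ (l.choose 2) * gaussG Q (n + 1) l *
      ∏ i ∈ Finset.range n, (1 - x * P * P ^ (l + i))) := by
          apply Finset.sum_congr rfl
          intro l _
          have e1 : ∏ i ∈ Finset.range (n + 1), (1 - x * P ^ (l + i))
              = (∏ i ∈ Finset.range n, (1 - x * P * P ^ (l + i))) * (1 - x * P ^ l) := by
            rw [Finset.prod_range_succ']
            congr 1
            apply Finset.prod_congr rfl
            intro i _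
            ring
          have e2 : ∏ i ∈ Finset.range (n + 1), (1 - x * P ^ (l + 1 + i))
              = (∏ i ∈ Finset.range n, (1 - x * P * P ^ (l + i))) *
                (1 - x * P ^ l * P ^ (n + 1)) := by
            rw [Finset.prod_range_succ]
            congr 1
            · apply Finset.prod_congr rfl
              intro i _
              ring
            · ring
          have e3 : Q ^ (n + 1) * P ^ (n + 1) = 1 := by rw [← mul_pow, hQP, one_pow]
          simp only [e1, e2]
          linear_combination ((-1 : ℂ) ^ l * Q ^ (l.choose 2) * gaussG Q (n + 1) l *
            (∏ i ∈ Finset.range n, (1 - x * P * P ^ (l + i))) * x * P ^ l) * e3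
      _ = 0 := by rw [← Finset.mul_sum, key, mul_zero]

lemma qP_add (Q P : ℂ) (hQP : Q * P = 1) (k : ℕ) : ∀ a : ℕ,
    qPoch Q Q (a + k) = qPoch Q Q a * ∏ i ∈ Finset.range k, (1 - Q ^ (a + k) * P ^ i) := by
  induction k with
  | zero => intro a; simp
  | succ k ih =>
    intro a
    have h := ih (a + 1)
    have e3 : Q ^ k * P ^ k = 1 := by rw [← mul_pow, hQP, one_pow]
    have e4 : Q ^ (a + 1 + k) * P ^ k = Q ^ (a + 1) := by
      rw [pow_add, mul_assoc, e3, mul_one]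
    rw [show a + (k + 1) = a + 1 + k by ring, h, Finset.prod_range_succ, e4, qP_succ]
    ring

lemma comp_sum (A B : ℕ → ℕ → ℂ)
    (h : ∀ r n, 2 * n ≤ r → ∑ l ∈ Finset.range (n + 1), A r l * B (r - 2 * l) (n - l)
      = if n = 0 then 1 else 0) (f g : ℕ → ℂ)
    (hf : ∀ m, f m = ∑ j ∈ Finset.range (m / 2 + 1), B m j * g (m - 2 * j)) (r : ℕ) :
    g r = ∑ l ∈ Finset.range (r / 2 + 1), A r l * f (r - 2 * l) := by
  have h1 : ∀ l ∈ Finset.range (r / 2 + 1), A r l * f (r - 2 * l)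
      = ∑ n ∈ Finset.Ico l (r / 2 + 1), A r l * B (r - 2 * l) (n - l) * g (r - 2 * n) := by
    intro l hl
    have hl' : l ≤ r / 2 := by simp at hl; omega
    rw [hf, Finset.mul_sum, Finset.sum_Ico_eq_sum_range]
    have e : (r - 2 * l) / 2 + 1 = r / 2 + 1 - l := by omega
    rw [e]
    apply Finset.sum_congr rfl
    intro j _
    rw [Nat.add_sub_cancel_left, show r - 2 * l - 2 * j = r - 2 * (l + j) by omega]
    ring
  rw [Finset.sum_congr rfl h1]
  rw [Finset.sum_comm' (t' := Finset.range (r / 2 + 1)) (s' := fun n => Finset.range (n + 1))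
    (by intro x y; simp; omega)]
  have h2 : ∀ n ∈ Finset.range (r / 2 + 1),
      ∑ l ∈ Finset.range (n + 1), A r l * B (r - 2 * l) (n - l) * g (r - 2 * n)
      = if n = 0 then g r else 0 := by
    intro n hn
    rw [← Finset.sum_mul, h r n (by simp at hn; omega)]
    by_cases h0 : n = 0 <;> simp [h0]
  rw [Finset.sum_congr rfl h2]
  simp

lemma inv_pair (A B : ℕ → ℕ → ℂ) (hA : ∀ r, A r 0 = 1)
    (h : ∀ r n, 2 * n ≤ r → ∑ l ∈ Finset.range (n + 1), A r l * B (r - 2 * l) (n - l)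
      = if n = 0 then 1 else 0) (f g : ℕ → ℂ) :
    (∀ r, g r = ∑ l ∈ Finset.range (r / 2 + 1), A r l * f (r - 2 * l)) ↔
    (∀ m, f m = ∑ j ∈ Finset.range (m / 2 + 1), B m j * g (m - 2 * j)) := by
  constructor
  · intro hg
    set f' : ℕ → ℂ := fun m => ∑ j ∈ Finset.range (m / 2 + 1), B m j * g (m - 2 * j) with hf'
    have h' := comp_sum A B h f' g (fun m => rfl)
    intro m
    change f m = f' m
    induction m using Nat.strong_induction_on with
    | _ m ih =>
      have e := (hg m).symm.trans (h' m)
      rw [Finset.sum_range_succ', Finset.sum_range_succ' (fun l => A m l * f' (m - 2 * l))] at e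
      have e' : ∑ k ∈ Finset.range (m / 2), A m (k + 1) * f (m - 2 * (k + 1))
          = ∑ k ∈ Finset.range (m / 2), A m (k + 1) * f' (m - 2 * (k + 1)) := by
        apply Finset.sum_congr rfl
        intro k hk
        have : k < m / 2 := by simpa using hk
        rw [ih _ (by omega)]
      rw [e'] at e
      simpa [hA] using e
  · intro hf
    exact comp_sum A B h f g hf

lemma qbinom_nat (Q : ℂ) (r l : ℕ) (h : 2 * l ≤ r) :
    qbinom Q ((r : ℤ) - l) l = qPoch Q Q (r - l) / (qPoch Q Q l * qPoch Q Q (r - 2 * l)) := by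
  unfold qbinom
  rw [if_pos (by omega)]
  congr 3
  · omega
  · congr 1; omega

/-- Inverse pair \eqref{gr}/\eqref{fm}, stated with q → q² so all exponents of q
are integers (interpreted via zpow since they may be negative). -/
theorem stmt_18 (q : ℂ) (hq0 : q ≠ 0)
    (hden : ∀ n : ℕ, qPoch (q ^ 2) (q ^ 2) n ≠ 0)
    (f g : ℕ → ℂ) :
    (∀ r : ℕ, g r = ∑ l ∈ Finset.range (r / 2 + 1),
        (-1 : ℂ) ^ l * q ^ ((l : ℤ) * (3 * l - 2 * r + 1)) *
          qbinom (q ^ 2) ((r : ℤ) - l) l * f (r - 2 * l))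
    ↔
    (∀ m : ℕ, f m = qPoch (q ^ 2) (q ^ 2) m *
        ∑ j ∈ Finset.range (m / 2 + 1),
          (1 - q ^ (2 * (m - 2 * j + 1))) * q ^ (2 * (j : ℤ) * ((j : ℤ) - m + 1)) *
            g (m - 2 * j) /
              (qPoch (q ^ 2) (q ^ 2) j * qPoch (q ^ 2) (q ^ 2) (m - j + 1))) := by
  have main := inv_pair
    (fun r l => (-1 : ℂ) ^ l * q ^ ((l : ℤ) * (3 * l - 2 * r + 1)) *
          qbinom (q ^ 2) ((r : ℤ) - l) l)
    (fun m j => qPoch (q ^ 2) (q ^ 2) m * ((1 - q ^ (2 * (m - 2 * j + 1))) *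
      q ^ (2 * (j : ℤ) * ((j : ℤ) - m + 1)) /
              (qPoch (q ^ 2) (q ^ 2) j * qPoch (q ^ 2) (q ^ 2) (m - j + 1))))
    ?_ ?_ f g
  · rw [main]
    apply forall_congr'
    intro m
    rw [Finset.mul_sum]
    apply Eq.congr_right
    apply Finset.sum_congr rfl
    intro j _
    ring
  · intro r
    have := qbinom_nat (q ^ 2) r 0 (by omega)
    simp only [this]
    have := hden r
    simp [qP_zero, this]
  · intro r n hn
    set Q := q ^ 2 with hQ
    have hQ0 : Q ≠ 0 := pow_ne_zero _ hq0
    rcases n with _ | n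
    · have h1 := qbinom_nat Q r 0 (by omega)
      have h2 := hden r
      have h3 := hden (r + 1)
      have h4 : 1 - q ^ (2 * (r + 1)) ≠ 0 := by
        intro h; rw [qP_succ, hQ, ← pow_mul, h, mul_zero] at h3; exact h3 rfl
      simp only [zero_add, Finset.sum_range_one, h1]
      simp [qP_zero, h2, qP_succ]
      rw [hQ, ← pow_mul]
      rw [← hQ]
      field_simp
    · rw [if_neg (by omega)]
      have key := S_zero Q Q⁻¹ (mul_inv_cancel₀ hQ0) n (Q ^ r)
      have e : ∀ l ∈ Finset.range (n + 1 + 1), 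
        (-1 : ℂ) ^ l * q ^ ((l : ℤ) * (3 * l - 2 * r + 1)) * qbinom Q ((r : ℤ) - l) l *
         (qPoch Q Q (r - 2 * l) * ((1 - q ^ (2 * (r - 2 * l - 2 * (n + 1 - l) + 1))) *
          q ^ (2 * ((n + 1 - l : ℕ) : ℤ) * (((n + 1 - l : ℕ) : ℤ) - (r - 2 * l : ℕ) + 1)) /
              (qPoch Q Q (n + 1 - l) * qPoch Q Q (r - 2 * l - (n + 1 - l) + 1))))
        = ((1 - q ^ (2 * (r - 2 * (n + 1) + 1))) * q ^ (2 * ((n : ℤ) + 1) * (n + 1 - r + 1))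
            / qPoch Q Q (n + 1)) *
          ((-1 : ℂ) ^ l * Q ^ (l.choose 2) * gaussG Q (n + 1) l *
      ∏ i ∈ Finset.range n, (1 - Q ^ r * Q⁻¹ ^ (l + i))) := by
        intro l hl
        have hl' : l ≤ n + 1 := by simp at hl; omega
        obtain ⟨k, hk⟩ := Nat.exists_eq_add_of_le hl'
        obtain ⟨s, hs⟩ := Nat.exists_eq_add_of_le hn
        have hg := gaussG_mul Q (n + 1) l k hk.symm
        have hp := qP_add Q Q⁻¹ (mul_inv_cancel₀ hQ0) n (k + s + 1)
        have i1 : k + s + 1 + n = r - l := by omega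
        have hprod : ∏ i ∈ Finset.range n, (1 - Q ^ (r - l) * Q⁻¹ ^ i)
            = ∏ i ∈ Finset.range n, (1 - Q ^ r * Q⁻¹ ^ (l + i)) := by
          apply Finset.prod_congr rfl
          intro i _
          have : Q ^ r * Q⁻¹ ^ l = Q ^ (r - l) := by
            rw [inv_pow, pow_sub₀ Q hQ0 (by omega)]
          rw [pow_add, ← mul_assoc, this]
        rw [i1, hprod] at hp
        have hz : q ^ ((l : ℤ) * (3 * l - 2 * r + 1)) *
            q ^ (2 * ((n + 1 - l : ℕ) : ℤ) * (((n + 1 - l : ℕ) : ℤ) - (r - 2 * l : ℕ) + 1))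
            = q ^ (2 * ((n : ℤ) + 1) * (n + 1 - r + 1)) * Q ^ (l.choose 2) := by
          have hc : (2 * (l.choose 2 : ℤ)) = l * (l - 1) := by
            have := Nat.triangle_succ
            have h2 : l.choose 2 * 2 = l * (l - 1) := by
              rw [Nat.choose_two_right]
              exact Nat.div_mul_cancel (Nat.even_mul_pred_self l).two_dvd
            rcases l with _ | l
            · simp
            · rw [Nat.add_sub_cancel] at h2
              push_cast
              have h3 : (((l + 1).choose 2 : ℤ)) * 2 = (l + 1) * l := by exact_mod_cast h2
              linarith
          rw [hQ, ← pow_mul, ← zpow_natCast, ← zpow_add₀ hq0, ← zpow_add₀ hq0]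
          congr 1
          rw [Nat.cast_sub hl', Nat.cast_sub (by omega : 2 * l ≤ r)]
          push_cast
          rw [hc]
          ring
        rw [qbinom_nat Q r l (by omega), hp]
        have j1 : r - 2 * l - 2 * (n + 1 - l) + 1 = r - 2 * (n + 1) + 1 := by omega
        have j2 : r - 2 * l - (n + 1 - l) + 1 = k + s + 1 := by omega
        have j3 : n + 1 - l = k := by omega
        rw [j1, j2]
        rw [j3] at hz ⊢
        rw [← hg]
        have d1 := hden l
        have d2 := hden k
        have d3 := hden (k + s + 1)
        have d4 := hden (r - 2 * l)
        have d5 : gaussG Q (n + 1) l ≠ 0 := by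
          intro h0; rw [h0, zero_mul] at hg; exact hden (n + 1) hg.symm
        generalize q ^ ((l : ℤ) * (3 * l - 2 * r + 1)) = X at hz ⊢
        generalize q ^ (2 * (k : ℤ) * ((k : ℤ) - (r - 2 * l : ℕ) + 1)) = Y at hz ⊢
        generalize q ^ (2 * ((n : ℤ) + 1) * (n + 1 - r + 1)) = Z at hz ⊢
        generalize ∏ i ∈ Finset.range n, (1 - Q ^ r * Q⁻¹ ^ (l + i)) = W
        generalize qPoch Q Q l = a at *
        generalize qPoch Q Q k = b at *
        generalize qPoch Q Q (k + s + 1) = c at *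
        generalize qPoch Q Q (r - 2 * l) = d at *
        generalize gaussG Q (n + 1) l = G at *
        generalize 1 - q ^ (2 * (r - 2 * (n + 1) + 1)) = V
        generalize Q ^ l.choose 2 = T at *
        have L : (-1 : ℂ) ^ l * X * (c * W / (a * d)) * (d * (V * Y / (b * c)))
            = (-1 : ℂ) ^ l * (X * Y) * W * V / (a * b) := by
          field_simp
        rw [L, hz]
        field_simp
      rw [Finset.sum_congr rfl e, ← Finset.mul_sum, key, mul_zero]
end

section
/- Theorem (k=2 case of Theorem 1): Σ_{n≥0} [ (q^{n+1};q)_n q^n / ((a;q)_{n+1} (q/a;q)_n) ] · Σ_{r=0}^{n} q^{r(r+1)} C[n,r]_q = Σ_{n≥0} a^n q^{2n(n+1)} + Σ_{i=1}^{4} (-1)^{i+1} a^i q^{i(i-1)/2} · (q^i;q^5)_∞ (q^{5-i};q^5)_∞ (q^5;q^5)_∞ / ((q;q)_∞ (a;q)_∞ (q/a;q)_∞) · Σ_{n≥0} a^{5n} q^{2n(5n+2i)}. -/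
open scoped BigOperators

open Filter Topology

namespace PT

section basics
variable {q : ℂ}

lemma summable_geom_mul (hq : ‖q‖ < 1) (x : ℂ) : Summable fun j : ℕ => ‖-(x * q ^ j)‖ := by
  simp only [norm_neg, norm_mul, norm_pow]
  exact (summable_geometric_of_lt_one (norm_nonneg _) hq).mul_left _

lemma multipliable_poch (hq : ‖q‖ < 1) (x : ℂ) : Multipliable fun j : ℕ => (1 - x * q ^ j) := by
  have := multipliable_one_add_of_summable (summable_geom_mul hq x)
  simpa [sub_eq_add_neg] using this

lemma tendsto_poch (hq : ‖q‖ < 1) (x : ℂ) :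
    Tendsto (fun n => qPoch x q n) atTop (𝓝 (qPochInf x q)) :=
  (multipliable_poch hq x).tendsto_prod_tprod_nat

lemma qPoch_zero (x q : ℂ) : qPoch x q 0 = 1 := by simp [qPoch]

lemma qPoch_succ (x q : ℂ) (n : ℕ) : qPoch x q (n + 1) = qPoch x q n * (1 - x * q ^ n) := by
  simp [qPoch, Finset.prod_range_succ]

lemma qPoch_succ' (x q : ℂ) (n : ℕ) : qPoch x q (n + 1) = (1 - x) * qPoch (x * q) q n := by
  simp only [qPoch, Finset.prod_range_succ']
  rw [mul_comm]
  simp [pow_succ', mul_assoc]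

lemma qPoch_add (x q : ℂ) (m n : ℕ) : qPoch x q (m + n) = qPoch x q m * qPoch (x * q ^ m) q n := by
  simp only [qPoch, Finset.prod_range_add, pow_add, mul_assoc]

lemma poch_split (hq : ‖q‖ < 1) (x : ℂ) (n : ℕ) :
    qPochInf x q = qPoch x q n * qPochInf (x * q ^ n) q := by
  have h1 := (tendsto_poch hq x).comp (tendsto_add_atTop_nat n)
  have h2 := (tendsto_poch hq (x * q ^ n)).const_mul (qPoch x q n)
  refine tendsto_nhds_unique h1 (h2.congr fun m => ?_)
  simp only [Function.comp]
  rw [add_comm m n, qPoch_add]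

lemma poch_succ (hq : ‖q‖ < 1) (x : ℂ) :
    qPochInf x q = (1 - x) * qPochInf (x * q) q := by
  have := poch_split hq x 1
  simpa [qPoch] using this

lemma poch_ne_zero (hq : ‖q‖ < 1) {x : ℂ} (h : ∀ j : ℕ, 1 - x * q ^ j ≠ 0) : qPochInf x q ≠ 0 := by
  have := tprod_one_add_ne_zero_of_summable (f := fun j : ℕ => -(x * q ^ j))
    (by simpa [sub_eq_add_neg] using h) (summable_geom_mul hq x)
  simpa [qPochInf, sub_eq_add_neg] using this

lemma qPoch_ne_zero {x : ℂ} (h : ∀ j : ℕ, 1 - x * q ^ j ≠ 0) (n : ℕ) : qPoch x q n ≠ 0 :=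
  Finset.prod_ne_zero_iff.mpr fun j _ => h j

lemma poch_one (hq : ‖q‖ < 1) : qPochInf 1 q = 0 := by
  rw [poch_succ hq]; simp

lemma poch_zero : qPochInf 0 q = 1 := by simp [qPochInf]

lemma sum_le_geom (hq : ‖q‖ < 1) (x : ℂ) (n : ℕ) :
    ∑ j ∈ Finset.range n, ‖-(x * q ^ j)‖ ≤ ‖x‖ / (1 - ‖q‖) := by
  have h := (summable_geom_mul hq x).sum_le_tsum (Finset.range n) (fun _ _ => norm_nonneg _)
  refine h.trans (le_of_eq ?_)
  simp only [norm_neg, norm_mul, norm_pow]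
  rw [tsum_mul_left, tsum_geometric_of_lt_one (norm_nonneg _) hq, div_eq_mul_inv]

lemma norm_qPoch_sub (hq : ‖q‖ < 1) (x : ℂ) (n : ℕ) :
    ‖qPoch x q n - 1‖ ≤ Real.exp (‖x‖ / (1 - ‖q‖)) - 1 := by
  have := Finset.norm_prod_one_add_sub_one_le (Finset.range n) (fun j => -(x * q ^ j))
  simp only [← sub_eq_add_neg] at this
  refine this.trans ?_
  have := sum_le_geom hq x n
  gcongr

lemma norm_poch_sub (hq : ‖q‖ < 1) (x : ℂ) :
    ‖qPochInf x q - 1‖ ≤ Real.exp (‖x‖ / (1 - ‖q‖)) - 1 :=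
  le_of_tendsto ((tendsto_poch hq x).sub_const 1).norm
    (Eventually.of_forall fun n => norm_qPoch_sub hq x n)

lemma norm_qPoch_le (hq : ‖q‖ < 1) {x : ℂ} {X : ℝ} (hX : ‖x‖ ≤ X) (n : ℕ) :
    ‖qPoch x q n‖ ≤ Real.exp (X / (1 - ‖q‖)) := by
  have h1 := norm_qPoch_sub hq x n
  have h2 : ‖qPoch x q n‖ ≤ ‖qPoch x q n - 1‖ + 1 := by
    simpa using norm_add_le (qPoch x q n - 1) 1
  have h3 : Real.exp (‖x‖ / (1 - ‖q‖)) ≤ Real.exp (X / (1 - ‖q‖)) := by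
    have : 0 < 1 - ‖q‖ := by linarith
    gcongr
  linarith

lemma norm_poch_le (hq : ‖q‖ < 1) {x : ℂ} {X : ℝ} (hX : ‖x‖ ≤ X) :
    ‖qPochInf x q‖ ≤ Real.exp (X / (1 - ‖q‖)) :=
  le_of_tendsto (tendsto_poch hq x).norm (Eventually.of_forall fun n => norm_qPoch_le hq hX n)

lemma poch_tendsto_one (hq : ‖q‖ < 1) {u : ℕ → ℂ} (hu : Tendsto u atTop (𝓝 0)) :
    Tendsto (fun m => qPochInf (u m) q) atTop (𝓝 1) := by
  rw [tendsto_iff_norm_sub_tendsto_zero]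
  refine squeeze_zero (fun _ => norm_nonneg _) (fun m => norm_poch_sub hq (u m)) ?_
  have h1 : Tendsto (fun m => Real.exp (‖u m‖ / (1 - ‖q‖)) - 1) atTop
      (𝓝 (Real.exp (‖(0 : ℂ)‖ / (1 - ‖q‖)) - 1)) :=
    ((Real.continuous_exp.tendsto _).comp (hu.norm.div_const _)).sub_const 1
  simpa using h1

/-- lower bound -/
lemma qPoch_inv_bound (hq : ‖q‖ < 1) {x : ℂ} (h : ∀ j : ℕ, 1 - x * q ^ j ≠ 0) :
    ∃ C : ℝ, 0 < C ∧ ∀ n, ‖(qPoch x q n)⁻¹‖ ≤ C := by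
  have ht := ((tendsto_poch hq x).inv₀ (poch_ne_zero hq h)).norm
  obtain ⟨C, hC⟩ := ht.bddAbove_range
  refine ⟨max C 1, by positivity, fun n => le_max_of_le_left (hC ⟨n, rfl⟩)⟩

lemma one_sub_ne (hq : ‖q‖ < 1) (j : ℕ) : 1 - q * q ^ j ≠ 0 := by
  intro h
  have h1 : q ^ (j + 1) = 1 := by rw [pow_succ']; linear_combination -h
  have h2 : ‖q‖ ^ (j + 1) < 1 := pow_lt_one₀ (norm_nonneg _) hq (by omega)
  rw [← norm_pow, h1] at h2
  simp at h2

lemma qq_ne (hq : ‖q‖ < 1) (n : ℕ) : qPoch q q n ≠ 0 := qPoch_ne_zero (one_sub_ne hq) n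

end basics


section product
variable {q : ℂ}

/-- summand of the Andrews-Warnaar product formula -/
noncomputable def sT (q a b : ℂ) (n : ℕ) : ℂ :=
  q ^ n * qPoch (a * b * q ^ (n - 1)) q n * qPochInf (a * q ^ n) q * qPochInf (b * q ^ n) q *
    qPochInf (q * q ^ n) q

/-- the partial theta function -/
noncomputable def pth (q x : ℂ) : ℂ := ∑' n : ℕ, (-1) ^ n * x ^ n * q ^ (n.choose 2)

/-- telescoping certificate -/
noncomputable def cert (q a b : ℂ) : ℕ → ℂ
  | 0 => 0
  | n + 1 => -a * q ^ (n + 1) * qPochInf (q * q ^ n) q * qPochInf (b * q ^ n) q *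
      qPochInf (a * q ^ (n + 2)) q * qPoch (a * b * q ^ (n + 1)) q n

lemma norm_mul_pow_le (hq : ‖q‖ < 1) {x : ℂ} {X : ℝ} (hX : ‖x‖ ≤ X) (n : ℕ) :
    ‖x * q ^ n‖ ≤ X := by
  rw [norm_mul, norm_pow]
  have h1 : ‖q‖ ^ n ≤ 1 := pow_le_one₀ (norm_nonneg _) hq.le
  calc ‖x‖ * ‖q‖ ^ n ≤ ‖x‖ * 1 := by gcongr
    _ ≤ X := by simpa using hX

lemma norm_sT_le (hq : ‖q‖ < 1) {A B : ℝ} : ∃ K : ℝ, ∀ a b : ℂ, ‖a‖ ≤ A → ‖b‖ ≤ B → ∀ n,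
    ‖sT q a b n‖ ≤ K * ‖q‖ ^ n := by
  refine ⟨Real.exp (A * B / (1 - ‖q‖)) * Real.exp (A / (1 - ‖q‖)) * Real.exp (B / (1 - ‖q‖)) *
    Real.exp (1 / (1 - ‖q‖)), fun a b ha hb n => ?_⟩
  have hab : ‖a * b‖ ≤ A * B := by
    rw [norm_mul]
    exact mul_le_mul ha hb (norm_nonneg _) ((norm_nonneg _).trans ha)
  have h1 := norm_qPoch_le hq (norm_mul_pow_le hq hab (n - 1)) n
  have h2 := norm_poch_le hq (norm_mul_pow_le hq ha n)
  have h3 := norm_poch_le hq (norm_mul_pow_le hq hb n)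
  have h4 := norm_poch_le hq (norm_mul_pow_le hq hq.le n)
  rw [sT, norm_mul, norm_mul, norm_mul, norm_mul, norm_pow]
  calc _ ≤ ‖q‖ ^ n * Real.exp (A * B / (1 - ‖q‖)) * Real.exp (A / (1 - ‖q‖)) *
        Real.exp (B / (1 - ‖q‖)) * Real.exp (1 / (1 - ‖q‖)) := by gcongr
    _ = _ := by ring

lemma summable_sT (hq : ‖q‖ < 1) (a b : ℂ) : Summable (sT q a b) := by
  obtain ⟨K, hK⟩ := norm_sT_le hq (A := ‖a‖) (B := ‖b‖)
  exact Summable.of_norm_bounded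
    ((summable_geometric_of_lt_one (norm_nonneg _) hq).mul_left K) (hK a b le_rfl le_rfl)

lemma cert_tendsto (hq : ‖q‖ < 1) (a b : ℂ) : Tendsto (cert q a b) atTop (𝓝 0) := by
  rw [← tendsto_add_atTop_iff_nat 1]
  have hb : ∀ n, ‖cert q a b (n + 1)‖ ≤ ‖q‖ ^ n * (‖a‖ * ‖q‖ * Real.exp (1 / (1 - ‖q‖)) *
      Real.exp (‖b‖ / (1 - ‖q‖)) * Real.exp (‖a‖ / (1 - ‖q‖)) *
      Real.exp (‖a * b‖ / (1 - ‖q‖))) := by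
    intro n
    have h1 := norm_qPoch_le hq (norm_mul_pow_le hq (le_refl ‖a * b‖) (n + 1)) n
    have h2 := norm_poch_le hq (norm_mul_pow_le hq (le_refl ‖a‖) (n + 2))
    have h3 := norm_poch_le hq (norm_mul_pow_le hq (le_refl ‖b‖) n)
    have h4 := norm_poch_le hq (norm_mul_pow_le hq hq.le n)
    simp only [cert]
    rw [norm_mul, norm_mul, norm_mul, norm_mul, norm_mul, norm_pow, norm_neg]
    calc _ ≤ ‖a‖ * ‖q‖ ^ (n + 1) * Real.exp (1 / (1 - ‖q‖)) *
      Real.exp (‖b‖ / (1 - ‖q‖)) * Real.exp (‖a‖ / (1 - ‖q‖)) *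
      Real.exp (‖a * b‖ / (1 - ‖q‖)) := by gcongr
      _ = _ := by ring
  refine squeeze_zero_norm hb ?_
  have := (tendsto_pow_atTop_nhds_zero_of_lt_one (norm_nonneg _) hq).mul_const
    (‖a‖ * ‖q‖ * Real.exp (1 / (1 - ‖q‖)) *
      Real.exp (‖b‖ / (1 - ‖q‖)) * Real.exp (‖a‖ / (1 - ‖q‖)) *
      Real.exp (‖a * b‖ / (1 - ‖q‖)))
  simpa using this

lemma cert_eq (hq : ‖q‖ < 1) (a b : ℂ) (n : ℕ) :
    sT q a b n + (a - 1) * sT q (a * q) b n - a * q * sT q (a * q * q) b n =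
      cert q a b (n + 1) - cert q a b n := by
  cases n with
  | zero =>
    simp only [sT, cert, qPoch_zero]
    have h1 := poch_succ hq a
    have h2 := poch_succ hq (a * q)
    have e : a * q ^ 2 = a * q * q := by ring
    simp only [pow_zero, mul_one, zero_add, pow_one, e]
    rw [h1, h2]
    ring
  | succ m =>
    simp only [sT, cert, Nat.add_sub_cancel]
    have h1 := poch_succ hq (a * q ^ (m + 1))
    have h2 := poch_succ hq (a * q * q ^ (m + 1))
    have h3 := poch_succ hq (q * q ^ m)
    have h4 := poch_succ hq (b * q ^ m)
    have k1 : qPoch (a * b * q ^ m) q (m + 1) =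
      (1 - a * b * q ^ m) * qPoch (a * b * q ^ (m + 1)) q m := by
      rw [qPoch_succ']; ring_nf
    have k2 : qPoch (a * q * b * q ^ m) q (m + 1) =
      qPoch (a * b * q ^ (m + 1)) q m * (1 - a * b * q ^ (m + 1) * q ^ m) := by
      rw [qPoch_succ]; ring_nf
    have k3 : qPoch (a * q * q * b * q ^ m) q (m + 1) =
      qPoch (a * b * q ^ (m + 1 + 1)) q (m + 1) := by ring_nf
    have e1 : a * q ^ (m + 1) * q = a * q * q ^ (m + 1) := by ring
    have e2 : a * q * q ^ (m + 1) * q = a * q * q * q ^ (m + 1) := by ring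
    have e3 : q * q ^ m * q = q * q ^ (m + 1) := by ring
    have e4 : b * q ^ m * q = b * q ^ (m + 1) := by ring
    have e5 : a * q ^ (m + 2) = a * q * q ^ (m + 1) := by ring
    have e6 : a * q ^ (m + 1 + 2) = a * q * q * q ^ (m + 1) := by ring
    rw [e1] at h1
    rw [e2] at h2
    rw [e3] at h3
    rw [e4] at h4
    rw [k1, k2, k3, e5, e6, h1, h2, h3, h4]
    ring

lemma S_rec (hq : ‖q‖ < 1) (a b : ℂ) :
    (∑' n, sT q a b n) + (a - 1) * (∑' n, sT q (a * q) b n)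
      - a * q * (∑' n, sT q (a * q * q) b n) = 0 := by
  have h := (((summable_sT hq a b).hasSum.add ((summable_sT hq (a * q) b).hasSum.mul_left (a - 1))).sub
    ((summable_sT hq (a * q * q) b).hasSum.mul_left (a * q))).tendsto_sum_nat
  refine tendsto_nhds_unique h ?_
  have : (fun N => ∑ n ∈ Finset.range N, (sT q a b n + (a - 1) * sT q (a * q) b n
      - a * q * sT q (a * q * q) b n)) = cert q a b := by
    funext N
    simp only [cert_eq hq]
    rw [Finset.sum_range_sub]
    simp [cert]
  rw [this]
  exact cert_tendsto hq a b

lemma tendsto_mul_pow (hq : ‖q‖ < 1) (a : ℂ) : Tendsto (fun m : ℕ => a * q ^ m) atTop (𝓝 0) := by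
  simpa using (tendsto_pow_atTop_nhds_zero_of_norm_lt_one hq).const_mul a

lemma qPoch_continuous (n : ℕ) : Continuous fun x : ℂ => qPoch x q n := by
  unfold qPoch
  fun_prop

lemma S_tendsto (hq : ‖q‖ < 1) (a b : ℂ) :
    Tendsto (fun m : ℕ => ∑' n, sT q (a * q ^ m) b n) atTop (𝓝 (∑' n, sT q 0 b n)) := by
  obtain ⟨K, hK⟩ := norm_sT_le hq (A := ‖a‖) (B := ‖b‖)
  refine tendsto_tsum_of_dominated_convergence
    (bound := fun n => K * ‖q‖ ^ n) ((summable_geometric_of_lt_one (norm_nonneg _) hq).mul_left K)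
    (fun n => ?_) (Eventually.of_forall fun m n =>
      hK _ _ (norm_mul_pow_le hq le_rfl m) le_rfl n)
  simp only [sT]
  have h0 := tendsto_mul_pow hq a
  have h1 : Tendsto (fun m : ℕ => qPoch (a * q ^ m * b * q ^ (n - 1)) q n) atTop
      (𝓝 (qPoch (0 * b * q ^ (n - 1)) q n)) :=
    ((qPoch_continuous n).tendsto _).comp ((h0.mul_const b).mul_const _)
  have h2 : Tendsto (fun m : ℕ => qPochInf (a * q ^ m * q ^ n) q) atTop
      (𝓝 (qPochInf (0 * q ^ n) q)) := by
    rw [zero_mul, poch_zero]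
    refine poch_tendsto_one hq ?_
    simpa using h0.mul_const (q ^ n)
  exact (((h1.const_mul _).mul h2).mul_const _).mul_const _

lemma S_first (hq : ‖q‖ < 1) (a b : ℂ) :
    (∑' n, sT q a b n) = (∑' n, sT q 0 b n) - a * (∑' n, sT q (a * q) b n) := by
  set S : ℂ → ℂ := fun x => ∑' n, sT q x b n with hS
  have hrec : ∀ m : ℕ, S (a * q ^ m) + a * q ^ m * S (a * q ^ (m + 1)) = S a + a * S (a * q) := by
    intro m
    induction m with
    | zero => simp
    | succ m ih =>
      rw [← ih]
      have := S_rec hq (a * q ^ m) b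
      have e1 : a * q ^ (m + 1) = a * q ^ m * q := by ring
      have e2 : a * q ^ (m + 1 + 1) = a * q ^ m * q * q := by ring
      simp only [hS]
      rw [e2, e1]
      linear_combination -this
  have ht : Tendsto (fun m : ℕ => S (a * q ^ m) + a * q ^ m * S (a * q ^ (m + 1))) atTop
      (𝓝 (S 0 + 0 * S 0)) :=
    (S_tendsto hq a b).add ((tendsto_mul_pow hq a).mul
      ((S_tendsto hq a b).comp (tendsto_add_atTop_nat 1)))
  have := tendsto_nhds_unique (tendsto_const_nhds.congr fun m => (hrec m).symm) ht
  change S a = S 0 - a * S (a * q)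
  linear_combination this

lemma summable_real_theta {X Q : ℝ} (hX : 0 ≤ X) (hQ : 0 ≤ Q) (hQ1 : Q < 1) :
    Summable fun n : ℕ => X ^ n * Q ^ (n.choose 2) := by
  refine summable_of_ratio_norm_eventually_le (r := 1 / 2) (by norm_num) ?_
  have h : Tendsto (fun n : ℕ => X * Q ^ n) atTop (𝓝 0) := by
    simpa using (tendsto_pow_atTop_nhds_zero_of_lt_one hQ hQ1).const_mul X
  filter_upwards [h.eventually (ge_mem_nhds (show (0 : ℝ) < 1 / 2 by norm_num))] with n hn
  rw [Real.norm_of_nonneg (by positivity), Real.norm_of_nonneg (by positivity)]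
  have : X ^ (n + 1) * Q ^ ((n + 1).choose 2) = (X * Q ^ n) * (X ^ n * Q ^ (n.choose 2)) := by
    rw [Nat.choose_succ_succ' n 1, Nat.choose_one_right]; ring
  rw [this]
  gcongr

lemma summable_pth (hq : ‖q‖ < 1) (x : ℂ) :
    Summable fun n : ℕ => (-1) ^ n * x ^ n * q ^ (n.choose 2) := by
  refine Summable.of_norm ?_
  simpa using summable_real_theta (norm_nonneg x) (norm_nonneg q) hq

lemma pth_rec (hq : ‖q‖ < 1) (x : ℂ) : pth q x = 1 - x * pth q (x * q) := by
  rw [pth, (summable_pth hq x).tsum_eq_zero_add, pth, ← tsum_mul_left, sub_eq_add_neg, ← tsum_neg]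
  congr 1
  · simp
  · refine tsum_congr fun n => ?_
    rw [Nat.choose_succ_succ' n 1, Nat.choose_one_right]; ring

lemma S_eq (hq : ‖q‖ < 1) (a b : ℂ) : (∑' n, sT q a b n) = pth q a * (∑' n, sT q 0 b n) := by
  set S : ℂ → ℂ := fun x => ∑' n, sT q x b n with hS
  have hrec : ∀ m : ℕ, S a = (∑ n ∈ Finset.range m, (-1) ^ n * a ^ n * q ^ (n.choose 2)) * S 0
      + ((-1) ^ m * a ^ m * q ^ (m.choose 2)) * S (a * q ^ m) := by
    intro m
    induction m with
    | zero => simp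
    | succ m ih =>
      have h1 : S (a * q ^ m) = S 0 - a * q ^ m * S (a * q ^ m * q) := S_first hq (a * q ^ m) b
      rw [ih, Finset.sum_range_succ, h1, Nat.choose_succ_succ' m 1, Nat.choose_one_right]
      have e1 : a * q ^ (m + 1) = a * q ^ m * q := by ring
      rw [e1]
      ring
  have ht := ((summable_pth hq a).hasSum.tendsto_sum_nat.mul_const (S 0)).add
    ((summable_pth hq a).tendsto_atTop_zero.mul (S_tendsto hq a b))
  have := tendsto_nhds_unique (tendsto_const_nhds.congr fun m => hrec m) ht
  change S a = _
  rw [this, pth]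
  simp [hS]

lemma sT_comm (a b : ℂ) (n : ℕ) : sT q a b n = sT q b a n := by
  simp only [sT, mul_comm a b]; ring

lemma S_zero (hq : ‖q‖ < 1) : (∑' n, sT q 0 0 n) = 1 := by
  refine tendsto_nhds_unique (summable_sT hq 0 0).hasSum.tendsto_sum_nat ?_
  have : ∀ N, ∑ n ∈ Finset.range N, sT q 0 0 n = qPochInf (q ^ N) q := by
    intro N
    induction N with
    | zero => simp [poch_one hq]
    | succ N ih =>
      rw [Finset.sum_range_succ, ih, poch_succ hq (q ^ N)]
      have h1 : ∀ n, qPoch 0 q n = 1 := by intro n; simp [qPoch]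
      simp only [sT, zero_mul, h1, poch_zero, pow_succ', mul_comm (q ^ N) q]
      ring
  simp only [this]
  exact poch_tendsto_one hq (tendsto_pow_atTop_nhds_zero_of_norm_lt_one hq)

/-- Andrews-Warnaar -/
theorem S_prod (hq : ‖q‖ < 1) (a b : ℂ) : (∑' n, sT q a b n) = pth q a * pth q b := by
  rw [S_eq hq a b]
  congr 1
  have h : (∑' n, sT q 0 b n) = ∑' n, sT q b 0 n := tsum_congr fun n => sT_comm 0 b n
  rw [h, S_eq hq b 0, S_zero hq, mul_one]

/-- summand of the Warnaar formula, with `x = a b / q` -/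
noncomputable def wT (q x a b : ℂ) : ℕ → ℂ
  | 0 => qPochInf q q * qPochInf a q * qPochInf b q
  | n + 1 => (1 - x) * qPoch (a * b * q ^ (n + 1)) q n * q ^ (n + 1) * qPochInf (q * q ^ (n + 1)) q *
      qPochInf (a * q ^ (n + 1)) q * qPochInf (b * q ^ (n + 1)) q

lemma wT_succ (hq : ‖q‖ < 1) {x a b : ℂ} (hx : a * b = x * q) (n : ℕ) :
    wT q x a b (n + 1) = sT q a b (n + 1) - a * b * sT q (a * q) (b * q) n := by
  simp only [wT, sT, Nat.add_sub_cancel]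
  have h3 := poch_succ hq (q * q ^ n)
  have e3 : q * q ^ n * q = q * q ^ (n + 1) := by ring
  rw [e3] at h3
  have k1 : qPoch (a * b * q ^ n) q (n + 1) =
      (1 - a * b * q ^ n) * qPoch (a * b * q ^ (n + 1)) q n := by
      rw [qPoch_succ']; ring_nf
  have k2 : qPoch (a * q * (b * q) * q ^ (n - 1)) q n = qPoch (a * b * q ^ (n + 1)) q n := by
    cases n with
    | zero => simp [qPoch]
    | succ n => simp only [Nat.add_sub_cancel]; ring_nf
  have e5 : a * q * q ^ n = a * q ^ (n + 1) := by ring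
  have e6 : b * q * q ^ n = b * q ^ (n + 1) := by ring
  rw [k1, k2, e5, e6, h3, hx]
  ring

theorem W_sum (hq : ‖q‖ < 1) {x a b : ℂ} (hx : a * b = x * q) :
    HasSum (wT q x a b) (pth q a + pth q b - 1) := by
  have h1 := (summable_sT hq a b)
  have h2 : HasSum (fun n => sT q a b (n + 1)) (pth q a * pth q b - sT q a b 0) := by
    have := h1.tsum_eq_zero_add
    rw [S_prod hq] at this
    rw [this, add_sub_cancel_left]
    exact ((summable_nat_add_iff 1).mpr h1).hasSum
  have h3 := (summable_sT hq (a * q) (b * q)).hasSum.mul_left (a * b)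
  rw [S_prod hq] at h3
  have h4 := h2.sub h3
  rw [← hasSum_nat_add_iff' 1]
  simp only [wT_succ hq hx]
  convert h4 using 1
  rw [pth_rec hq a, pth_rec hq b]
  simp [wT, sT, qPoch_zero]
  ring

/-- Jacobi triple product -/
theorem jacobi (hq : ‖q‖ < 1) {a b : ℂ} (hab : a * b = q) :
    pth q a + pth q b - 1 = qPochInf q q * qPochInf a q * qPochInf b q := by
  have h := W_sum hq (x := 1) (a := a) (b := b) (by simpa using hab)
  refine h.unique ?_
  have : wT q 1 a b 0 = qPochInf q q * qPochInf a q * qPochInf b q := rfl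
  rw [← this]
  refine hasSum_single 0 fun n hn => ?_
  obtain ⟨m, rfl⟩ := Nat.exists_eq_succ_of_ne_zero hn
  simp [wT]

end product


section bailey
variable {q : ℂ}

lemma qq_succ (q : ℂ) (n : ℕ) : qPoch q q (n + 1) = qPoch q q n * (1 - q ^ (n + 1)) := by
  rw [qPoch_succ, pow_succ']

lemma one_sub_pow_ne (hq : ‖q‖ < 1) (n : ℕ) : 1 - q ^ (n + 1) ≠ 0 := by
  rw [pow_succ']; exact one_sub_ne hq n

lemma vander (hq : ‖q‖ < 1) (N : ℕ) : ∀ c : ℕ,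
    ∑ j ∈ Finset.range (N + 1), q ^ (j * (j + c)) /
      (qPoch q q (N - j) * qPoch q q j * qPoch q q (j + c)) =
      1 / (qPoch q q N * qPoch q q (N + c)) := by
  induction N with
  | zero => intro c; simp [qPoch_zero]
  | succ N ih =>
    intro c
    have hne := qq_ne hq
    have h1 := one_sub_pow_ne hq N
    have key : (1 - q ^ (N + 1)) * ∑ j ∈ Finset.range (N + 1 + 1), q ^ (j * (j + c)) /
        (qPoch q q (N + 1 - j) * qPoch q q j * qPoch q q (j + c)) =
        1 / (qPoch q q N * qPoch q q (N + (c + 1))) := by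
      rw [← ih (c + 1), Finset.mul_sum]
      have hsplit : ∀ j ∈ Finset.range (N + 1 + 1), (1 - q ^ (N + 1)) * (q ^ (j * (j + c)) /
        (qPoch q q (N + 1 - j) * qPoch q q j * qPoch q q (j + c))) =
        (q ^ j * (1 - q ^ (N + 1 - j))) * (q ^ (j * (j + c)) /
        (qPoch q q (N + 1 - j) * qPoch q q j * qPoch q q (j + c))) +
        (1 - q ^ j) * (q ^ (j * (j + c)) /
        (qPoch q q (N + 1 - j) * qPoch q q j * qPoch q q (j + c))) := by
        intro j hj
        have hj' : j ≤ N + 1 := by simpa [Nat.lt_succ_iff] using hj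
        have : q ^ (N + 1) = q ^ j * q ^ (N + 1 - j) := by rw [← pow_add]; congr 1; omega
        rw [this]; ring
      rw [Finset.sum_congr rfl hsplit, Finset.sum_add_distrib, Finset.sum_range_succ,
        Finset.sum_range_succ' (fun j => (1 - q ^ j) * _)]
      simp only [Nat.sub_self, pow_zero, sub_self, mul_zero, zero_mul, add_zero]
      rw [← Finset.sum_add_distrib]
      refine Finset.sum_congr rfl fun j hj => ?_
      have hj' : j ≤ N := by simpa [Nat.lt_succ_iff] using hj
      obtain ⟨t, rfl⟩ := Nat.exists_eq_add_of_le hj'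
      have e1 : j + t + 1 - j = t + 1 := by omega
      have e2 : j + t + 1 - (j + 1) = t := by omega
      have e3 : j + t - j = t := by omega
      have e4 : j + 1 + c = j + c + 1 := by omega
      have e5 : j + (c + 1) = j + c + 1 := by omega
      rw [e1, e2, e3, e4, e5, qq_succ q t, qq_succ q j, qq_succ q (j + c)]
      have n1 := hne t
      have n2 := hne j
      have n3 := hne (j + c)
      have n4 := one_sub_pow_ne hq t
      have n5 := one_sub_pow_ne hq j
      have n6 := one_sub_pow_ne hq (j + c)
      field_simp
      ring
    have e : N + 1 + c = N + (c + 1) := by omega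
    rw [e, qq_succ q N]
    have n1 := hne N
    have n2 := hne (N + (c + 1))
    rw [eq_div_iff (by simp [n1, n2, h1])]
    rw [eq_div_iff (by simp [n1, n2])] at key
    linear_combination key

/-- Bailey transform relative to `q` -/
noncomputable def bB (q : ℂ) (α : ℕ → ℂ) (n : ℕ) : ℂ :=
  ∑ r ∈ Finset.range (n + 1), α r / (qPoch q q (n - r) * qPoch q q (n + r + 1))

lemma bailey_step (hq : ‖q‖ < 1) (α : ℕ → ℂ) (n : ℕ) :
    ∑ m ∈ Finset.range (n + 1), q ^ (m * (m + 1)) / qPoch q q (n - m) * bB q α m =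
      bB q (fun r => q ^ (r * (r + 1)) * α r) n := by
  simp only [bB, Finset.mul_sum]
  rw [Finset.sum_comm' (t' := Finset.range (n + 1)) (s' := fun r => Finset.Ico r (n + 1))]
  · refine Finset.sum_congr rfl fun r hr => ?_
    have hr' : r ≤ n := by simpa [Nat.lt_succ_iff] using hr
    obtain ⟨N, rfl⟩ := Nat.exists_eq_add_of_le hr'
    rw [Finset.sum_Ico_eq_sum_range]
    have e0 : r + N + 1 - r = N + 1 := by omega
    have e1 : r + N - r = N := by omega
    have e2 : r + N + r + 1 = N + (2 * r + 1) := by omega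
    rw [e0, e1, e2]
    have hv := vander hq N (2 * r + 1)
    rw [div_eq_mul_one_div, ← hv, Finset.mul_sum]
    refine Finset.sum_congr rfl fun j hj => ?_
    have e3 : r + N - (r + j) = N - j := by omega
    have e4 : r + j - r = j := by omega
    have e5 : r + j + r + 1 = j + (2 * r + 1) := by omega
    rw [e3, e4, e5]
    have e6 : (r + j) * (r + j + 1) = r * (r + 1) + j * (j + (2 * r + 1)) := by ring
    rw [e6, pow_add]
    have n1 := qq_ne hq (N - j)
    have n2 := qq_ne hq j
    have n3 := qq_ne hq (j + (2 * r + 1))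
    field_simp
  · intro x y
    simp only [Finset.mem_range, Finset.mem_Ico]
    omega

/-- unit Bailey pair -/
noncomputable def al0 (q : ℂ) (r : ℕ) : ℂ := (-1) ^ r * q ^ (r.choose 2) * (1 - q ^ (2 * r + 1))

lemma unit_partial (hq : ‖q‖ < 1) (R : ℕ) : ∀ t : ℕ,
    ∑ r ∈ Finset.range (R + 1), al0 q r / (qPoch q q (R + 1 + t - r) * qPoch q q (R + 1 + t + r + 1)) =
      (-1) ^ R * q ^ ((R + 1).choose 2) * (1 - q ^ (R + 1)) /
        ((1 - q ^ (R + 1 + t)) * (qPoch q q t * qPoch q q (R + 1 + t + R + 1))) := by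
  induction R with
  | zero =>
    intro t
    have e : 0 + 1 + t = t + 1 := by omega
    simp only [zero_add, Finset.sum_range_one, al0]
    have e2 : 1 + t - 0 = t + 1 := by omega
    have e3 : 1 + t = t + 1 := by omega
    rw [e2, e3, qq_succ q t]
    have n1 := qq_ne hq t
    have n2 := qq_ne hq (t + 1 + 0 + 1)
    have n3 := one_sub_pow_ne hq t
    simp
    field_simp
  | succ R ih =>
    intro t
    rw [Finset.sum_range_succ]
    have e1 : R + 1 + 1 + t = R + 1 + (t + 1) := by omega
    rw [e1, ih (t + 1)]
    have e2 : R + 1 + (t + 1) - (R + 1) = t + 1 := by omega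
    have e3 : R + 1 + (t + 1) + (R + 1) + 1 = R + 1 + (t + 1) + R + 1 + 1 := by omega
    have e4 : R + 1 + (t + 1) = (R + 1 + t) + 1 := by omega
    rw [e2, e3, qq_succ q t, qq_succ q (R + 1 + (t + 1) + R + 1), al0,
      Nat.choose_succ_succ' (R + 1) 1, Nat.choose_one_right]
    have n1 := qq_ne hq t
    have n2 := qq_ne hq (R + 1 + (t + 1) + R + 1)
    have n3 := one_sub_pow_ne hq t
    have n4 := one_sub_pow_ne hq (R + 1 + (t + 1) + R + 1)
    have n5 : 1 - q ^ (R + 1 + (t + 1)) ≠ 0 := by rw [e4]; exact one_sub_pow_ne hq _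
    field_simp
    ring

lemma unit_pair (hq : ‖q‖ < 1) (m : ℕ) : bB q (al0 q) m = if m = 0 then 1 else 0 := by
  cases m with
  | zero =>
    have n1 := one_sub_pow_ne hq 0
    simp at n1
    simp [bB, al0, qPoch]
    exact n1
  | succ m =>
    rw [bB, Finset.sum_range_succ]
    have h := unit_partial hq m 0
    simp only [add_zero] at h
    rw [h]
    simp only [Nat.sub_self, qPoch_zero, one_mul, al0]
    have e : m + 1 + (m + 1) + 1 = m + 1 + m + 1 + 1 := by omega
    have e' : 2 * (m + 1) + 1 = m + 1 + m + 1 + 1 := by omega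
    rw [e, e', qq_succ q (m + 1 + m + 1)]
    have n1 := qq_ne hq (m + 1 + m + 1)
    have n2 := one_sub_pow_ne hq (m + 1 + m + 1)
    have n3 := one_sub_pow_ne hq m
    simp
    field_simp
    ring

lemma pair1 (hq : ‖q‖ < 1) (n : ℕ) :
    bB q (fun r => q ^ (r * (r + 1)) * al0 q r) n = 1 / qPoch q q n := by
  rw [← bailey_step hq]
  simp only [unit_pair hq]
  rw [Finset.sum_range_succ']
  simp

noncomputable def al2 (q : ℂ) (r : ℕ) : ℂ := q ^ (r * (r + 1)) * (q ^ (r * (r + 1)) * al0 q r)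

lemma pair2 (hq : ‖q‖ < 1) (n : ℕ) :
    ∑ m ∈ Finset.range (n + 1), q ^ (m * (m + 1)) / (qPoch q q (n - m) * qPoch q q m) =
    bB q (al2 q) n := by
  have := bailey_step hq (fun r => q ^ (r * (r + 1)) * al0 q r) n
  simp only [pair1 hq] at this
  rw [show al2 q = fun r => q ^ (r * (r + 1)) * (q ^ (r * (r + 1)) * al0 q r) from rfl, ← this]
  refine Finset.sum_congr rfl fun m _ => ?_
  rw [div_mul_div_comm, mul_one]

end bailey


section main
variable {q a : ℂ}

noncomputable def dl (q a : ℂ) (n : ℕ) : ℂ :=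
  q ^ n * qPoch q q (2 * n) / (qPoch a q (n + 1) * qPoch (q / a) q n)

lemma ne1 (hq0 : q ≠ 0) (ha' : ∀ n : ℤ, a ≠ q ^ n) (j : ℕ) : 1 - a * q ^ j ≠ 0 := by
  intro h
  apply ha' (-(j : ℤ))
  have h1 : q ^ j ≠ 0 := pow_ne_zero _ hq0
  rw [zpow_neg, zpow_natCast]
  field_simp
  linear_combination -h

lemma ne2 (hq0 : q ≠ 0) (ha : a ≠ 0) (ha' : ∀ n : ℤ, a ≠ q ^ n) (j : ℕ) :
    1 - q / a * q ^ j ≠ 0 := by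
  intro h
  apply ha' ((j + 1 : ℕ) : ℤ)
  rw [zpow_natCast]
  field_simp at h
  rw [pow_succ']
  linear_combination h

lemma term_eq (hq : ‖q‖ < 1) (n : ℕ) :
    (qPoch (q ^ (n + 1)) q n * q ^ n / (qPoch a q (n + 1) * qPoch (q / a) q n)) *
        ∑ r ∈ Finset.range (n + 1), q ^ (r * (r + 1)) * qbinom q n r =
      dl q a n * bB q (al2 q) n := by
  have h1 : ∑ r ∈ Finset.range (n + 1), q ^ (r * (r + 1)) * qbinom q n r =
      qPoch q q n * bB q (al2 q) n := by
    rw [← pair2 hq, Finset.mul_sum]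
    refine Finset.sum_congr rfl fun r hr => ?_
    have hr' : r ≤ n := by simpa [Nat.lt_succ_iff] using hr
    have e : ((n : ℤ) - r).toNat = n - r := by omega
    rw [qbinom, if_pos (by omega), e, Int.toNat_natCast, Int.toNat_natCast]
    ring
  have h2 : qPoch q q (2 * n) = qPoch q q n * qPoch (q ^ (n + 1)) q n := by
    rw [two_mul, qPoch_add, pow_succ']
  rw [h1, dl, h2]
  ring

/-- double summand -/
noncomputable def gg (q a : ℂ) (r j : ℕ) : ℂ :=
  dl q a (r + j) * al2 q r / (qPoch q q j * qPoch q q (r + j + r + 1))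

lemma dl_bound (hq : ‖q‖ < 1) (hq0 : q ≠ 0) (ha : a ≠ 0) (ha' : ∀ n : ℤ, a ≠ q ^ n) :
    ∃ K : ℝ, 0 < K ∧ ∀ n, ‖dl q a n‖ ≤ K * ‖q‖ ^ n := by
  obtain ⟨C1, h1, hC1⟩ := qPoch_inv_bound hq (ne1 hq0 ha')
  obtain ⟨C2, h2, hC2⟩ := qPoch_inv_bound hq (ne2 hq0 ha ha')
  refine ⟨Real.exp (1 / (1 - ‖q‖)) * C1 * C2, by positivity, fun n => ?_⟩
  have h3 := norm_qPoch_le hq hq.le (2 * n)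
  rw [dl, div_eq_mul_inv, mul_inv, norm_mul, norm_mul, norm_mul, norm_pow]
  have h4 := hC1 (n + 1)
  have h5 := hC2 n
  calc _ ≤ ‖q‖ ^ n * Real.exp (1 / (1 - ‖q‖)) * (C1 * C2) := by gcongr
    _ = _ := by ring

lemma al2_bound (hq : ‖q‖ < 1) (r : ℕ) : ‖al2 q r‖ ≤ 2 := by
  have hp : ∀ k : ℕ, ‖q‖ ^ k ≤ 1 := fun k => pow_le_one₀ (norm_nonneg _) hq.le
  have h1 : ‖1 - q ^ (2 * r + 1)‖ ≤ 2 := by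
    refine (norm_sub_le _ _).trans ?_
    rw [norm_one, norm_pow]
    linarith [hp (2 * r + 1)]
  simp only [al2, al0, norm_mul, norm_pow, norm_neg, norm_one, one_pow, one_mul]
  have := hp (r * (r + 1))
  have := hp (r.choose 2)
  calc _ ≤ (1 : ℝ) * (1 * (1 * 2)) := by gcongr
    _ = 2 := by ring

lemma gg_summable (hq : ‖q‖ < 1) (hq0 : q ≠ 0) (ha : a ≠ 0) (ha' : ∀ n : ℤ, a ≠ q ^ n) :
    Summable fun p : ℕ × ℕ => gg q a p.1 p.2 := by
  obtain ⟨K, hK, hd⟩ := dl_bound hq hq0 ha ha'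
  obtain ⟨C, hC0, hC⟩ := qPoch_inv_bound hq (one_sub_ne hq)
  have hg := summable_geometric_of_lt_one (norm_nonneg _) hq
  have hs := (hg.mul_of_nonneg hg (fun _ => by positivity) (fun _ => by positivity)).mul_left
    (K * 2 * (C * C))
  refine Summable.of_norm_bounded hs fun p => ?_
  rw [gg, div_eq_mul_inv, mul_inv, norm_mul, norm_mul, norm_mul]
  have h1 := hd (p.1 + p.2)
  have h2 := al2_bound hq p.1
  have h3 := hC p.2
  have h4 := hC (p.1 + p.2 + p.1 + 1)
  calc _ ≤ K * ‖q‖ ^ (p.1 + p.2) * 2 * (C * C) := by gcongr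
    _ = _ := by rw [pow_add]; ring

lemma lhs_swap (hq : ‖q‖ < 1) (hq0 : q ≠ 0) (ha : a ≠ 0) (ha' : ∀ n : ℤ, a ≠ q ^ n) :
    ∑' n, dl q a n * bB q (al2 q) n = ∑' r, ∑' j, gg q a r j := by
  have hs := gg_summable hq hq0 ha ha'
  have h0 : ∑' p : ℕ × ℕ, gg q a p.1 p.2 = ∑' r, ∑' j, gg q a r j := hs.tsum_prod
  rw [← h0,
    ← (Finset.HasAntidiagonal.sigmaAntidiagonalEquivProd (A := ℕ)).tsum_eq]
  have hs' := (Finset.HasAntidiagonal.sigmaAntidiagonalEquivProd (A := ℕ)).summable_iff.mpr hs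
  refine Eq.trans ?_ (hs'.tsum_sigma' (fun n => (hasSum_fintype _).summable)).symm
  refine tsum_congr fun n => ?_
  rw [tsum_fintype]
  have : ∑ x : Finset.HasAntidiagonal.antidiagonal n, gg q a x.1.1 x.1.2 =
      ∑ p ∈ Finset.HasAntidiagonal.antidiagonal n, gg q a p.1 p.2 := by
    rw [Finset.sum_coe_sort (Finset.HasAntidiagonal.antidiagonal n) (fun p => gg q a p.1 p.2)]
  refine Eq.trans ?_ this.symm
  rw [Finset.Nat.sum_antidiagonal_eq_sum_range_succ (fun i j => gg q a i j), bB, Finset.mul_sum]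
  refine Finset.sum_congr rfl fun r hr => ?_
  have hr' : r ≤ n := by simpa [Nat.lt_succ_iff] using hr
  have e : r + (n - r) = n := by omega
  rw [gg, e]
  ring

lemma gg_eq (hq : ‖q‖ < 1) (hq0 : q ≠ 0) (ha : a ≠ 0) (ha' : ∀ n : ℤ, a ≠ q ^ n) (r j : ℕ) :
    (qPochInf q q * qPochInf a q * qPochInf (q / a) q) * gg q a r j =
      ((-1) ^ r * q ^ (r.choose 2) * q ^ (r * (r + 1)) * q ^ (r * (r + 1)) * q ^ r) *
        wT q (q ^ (2 * r + 1)) (a * q ^ (r + 1)) (q / a * q ^ r) j := by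
  have s1 := poch_split hq q j
  have s2 := poch_split hq a (r + j + 1)
  have s3 := poch_split hq (q / a) (r + j)
  have n1 := qq_ne hq j
  have n2 := qq_ne hq (r + j + r + 1)
  have n3 := qPoch_ne_zero (ne1 hq0 ha') (r + j + 1)
  have n4 := qPoch_ne_zero (ne2 hq0 ha ha') (r + j)
  rw [gg, dl, s1, s2, s3, al2, al0]
  cases j with
  | zero =>
    have e1 : 2 * (r + 0) = 2 * r := by omega
    have e2 : r + 0 + r + 1 = 2 * r + 1 := by omega
    have n5 := qq_ne hq (2 * r)
    have n6 := one_sub_pow_ne hq (2 * r)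
    rw [e1, e2, qq_succ q (2 * r)]
    simp only [wT, add_zero, pow_zero, mul_one, qPoch_zero, one_mul] at *
    field_simp
  | succ i =>
    have e1 : 2 * (r + (i + 1)) = (r + (i + 1) + r + 1) + i := by omega
    have e3 : a * q ^ (r + 1) * q ^ (i + 1) = a * q ^ (r + (i + 1) + 1) := by
      rw [mul_assoc, ← pow_add]; congr 2; omega
    have e4 : q / a * q ^ r * q ^ (i + 1) = q / a * q ^ (r + (i + 1)) := by
      rw [mul_assoc, ← pow_add]
    have e5 : a * q ^ (r + 1) * (q / a * q ^ r) * q ^ (i + 1) = q * q ^ (r + (i + 1) + r + 1) := by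
      field_simp
      ring
    simp only [wT]
    rw [e1, qPoch_add q q (r + (i + 1) + r + 1) i, e3, e4, e5]
    field_simp
    ring

theorem lhs_eq (hq : ‖q‖ < 1) (hq0 : q ≠ 0) (ha : a ≠ 0) (ha' : ∀ n : ℤ, a ≠ q ^ n) :
    (qPochInf q q * qPochInf a q * qPochInf (q / a) q) *
      ∑' n : ℕ, (qPoch (q ^ (n + 1)) q n * q ^ n / (qPoch a q (n + 1) * qPoch (q / a) q n)) *
        ∑ r ∈ Finset.range (n + 1), q ^ (r * (r + 1)) * qbinom q n r =
    ∑' r : ℕ, ((-1) ^ r * q ^ (r.choose 2) * q ^ (r * (r + 1)) * q ^ (r * (r + 1)) * q ^ r) *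
      (pth q (a * q ^ (r + 1)) + pth q (q / a * q ^ r) - 1) := by
  simp only [term_eq hq]
  rw [lhs_swap hq hq0 ha ha', ← tsum_mul_left]
  refine tsum_congr fun r => ?_
  rw [← tsum_mul_left]
  simp only [gg_eq hq hq0 ha ha']
  rw [tsum_mul_left, (W_sum hq (x := q ^ (2 * r + 1)) (a := a * q ^ (r + 1))
    (b := q / a * q ^ r) (by field_simp; ring)).tsum_eq]

end main


section final
variable {q a : ℂ}

def tri (k : ℤ) : ℤ := k * (k - 1) / 2

lemma two_tri (k : ℤ) : 2 * tri k = k * (k - 1) := by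
  have h : Even (k * (k - 1)) := Int.even_mul_pred_self k
  exact Int.mul_ediv_cancel' h.two_dvd

lemma two_choose (n : ℕ) : 2 * ((n.choose 2 : ℕ) : ℤ) = n * (n - 1) := by
  induction n with
  | zero => simp
  | succ n ih =>
    rw [Nat.choose_succ_succ' n 1, Nat.choose_one_right]
    push_cast
    linarith

lemma sgn_congr {m n : ℤ} (h : Even (m - n)) : (-1 : ℂ) ^ m = (-1) ^ n := by
  obtain ⟨t, ht⟩ := h
  have : m = n + 2 * t := by omega
  rw [this, zpow_add₀ (by norm_num), zpow_mul]
  simp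

/-- monomial -/
noncomputable def mono (q a : ℂ) (s m e : ℤ) : ℂ := (-1) ^ s * a ^ m * q ^ e

lemma mono_congr {s m e s' m' e' : ℤ} (hs : Even (s - s')) (hm : m = m') (he : e = e') :
    mono q a s m e = mono q a s' m' e' := by
  rw [mono, mono, sgn_congr hs, hm, he]

lemma mono_mul (hq0 : q ≠ 0) (ha : a ≠ 0) (s m e s' m' e' : ℤ) :
    mono q a s m e * mono q a s' m' e' = mono q a (s + s') (m + m') (e + e') := by
  simp only [mono]
  rw [zpow_add₀ (by norm_num), zpow_add₀ ha, zpow_add₀ hq0]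
  ring

lemma mono_nat (s m e : ℕ) : mono q a s m e = (-1) ^ s * a ^ m * q ^ e := by
  simp [mono]

lemma mono_neg (ha : a ≠ 0) (s m e : ℕ) : mono q a s (-(m : ℤ)) e = (-1) ^ s * (a⁻¹) ^ m * q ^ e := by
  simp [mono]

lemma hasSum_cg {ι : Type*} {f g : ι → ℂ} {x : ℂ} (h : ∀ i, f i = g i)
    (hg : HasSum g x) : HasSum f x := by
  rwa [show f = g from funext h]

lemma theta_int (hq : ‖q‖ < 1) (hq0 : q ≠ 0) (ha : a ≠ 0) :
    HasSum (fun k : ℤ => mono q a k k (tri k)) (qPochInf q q * qPochInf a q * qPochInf (q / a) q) := by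
  rw [← jacobi hq (by field_simp : a * (q / a) = q)]
  have h0 : mono q a 0 0 (tri 0) = 1 := by simp [mono, tri]
  rw [← h0]
  refine HasSum.of_nat_of_neg (f := fun k : ℤ => mono q a k k (tri k)) ?_ ?_
  · refine hasSum_cg ?_ (summable_pth hq a).hasSum
    intro n
    have e : tri n = ((n.choose 2 : ℕ) : ℤ) := by
      have := two_tri n
      have := two_choose n
      linarith
    rw [e, mono_nat]
  · refine hasSum_cg ?_ (summable_pth hq (q / a)).hasSum
    intro n
    have e : tri (-n) = ((n + n.choose 2 : ℕ) : ℤ) := by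
      have := two_tri (-n)
      have := two_choose n
      push_cast
      linarith
    rw [e, mono_congr (s' := n) (m' := -n) (e' := (n + n.choose 2 : ℕ)) ⟨-n, by ring⟩ rfl rfl,
      mono_neg ha, pow_add, div_pow, inv_pow]
    field_simp

noncomputable def LL (q a : ℂ) (r : ℕ) (k : ℤ) : ℂ :=
  mono q a (r + k) k (5 * tri (r + 1) + |k| * r + tri (|k| + 1))

lemma LL_hasSum (hq : ‖q‖ < 1) (hq0 : q ≠ 0) (ha : a ≠ 0) (r : ℕ) :
    HasSum (LL q a r)
      (((-1) ^ r * q ^ (r.choose 2) * q ^ (r * (r + 1)) * q ^ (r * (r + 1)) * q ^ r) *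
      (pth q (a * q ^ (r + 1)) + pth q (q / a * q ^ r) - 1)) := by
  have h0 : ((-1) ^ r * q ^ (r.choose 2) * q ^ (r * (r + 1)) * q ^ (r * (r + 1)) * q ^ r) =
      LL q a r 0 := by
    have e : (5 * tri (r + 1) + |0| * r + tri (|0| + 1)) =
        ((r.choose 2 + r * (r + 1) + r * (r + 1) + r : ℕ) : ℤ) := by
      have h1 := two_tri (r + 1)
      have h2 := two_choose r
      have h3 := two_tri 1
      simp only [abs_zero, zero_mul, zero_add, add_zero]
      push_cast
      linarith
    rw [LL, e, add_zero, mono]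
    simp only [zpow_natCast, zpow_zero, pow_add]
    ring
  rw [mul_sub, mul_add]
  rw [mul_one]
  nth_rewrite 3 [h0]
  refine HasSum.of_nat_of_neg (f := LL q a r) ?_ ?_
  · refine hasSum_cg ?_ ((summable_pth hq (a * q ^ (r + 1))).hasSum.mul_left _)
    intro n
    have e : (5 * tri (r + 1) + |(n : ℤ)| * r + tri (|(n : ℤ)| + 1)) =
        ((r.choose 2 + r * (r + 1) + r * (r + 1) + r + (r + 1) * n + n.choose 2 : ℕ) : ℤ) := by
      have h1 := two_tri (r + 1)
      have h2 := two_choose r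
      have h3 := two_tri (n + 1)
      have h4 := two_choose n
      rw [Nat.abs_cast]
      push_cast
      linarith
    rw [LL, e, ← Nat.cast_add, mono_nat]
    simp only [pow_add, mul_pow, ← pow_mul]
    ring
  · refine hasSum_cg ?_ ((summable_pth hq (q / a * q ^ r)).hasSum.mul_left _)
    intro n
    have e : (5 * tri (r + 1) + |-(n : ℤ)| * r + tri (|-(n : ℤ)| + 1)) =
        ((r.choose 2 + r * (r + 1) + r * (r + 1) + r + r * n + n + n.choose 2 : ℕ) : ℤ) := by
      have h1 := two_tri (r + 1)
      have h2 := two_choose r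
      have h3 := two_tri (n + 1)
      have h4 := two_choose n
      rw [abs_neg, Nat.abs_cast]
      push_cast
      linarith
    rw [LL, e, mono_congr (s' := (r + n : ℕ)) (m' := -n)
      (e' := (r.choose 2 + r * (r + 1) + r * (r + 1) + r + r * n + n + n.choose 2 : ℕ))
      ⟨-n, by push_cast; ring⟩ rfl rfl,
      mono_neg ha]
    simp only [pow_add, mul_pow, ← pow_mul, div_pow, inv_pow]
    field_simp

lemma LL_summable (hq : ‖q‖ < 1) (hq0 : q ≠ 0) (ha : a ≠ 0) :
    Summable fun p : ℕ × ℤ => LL q a p.1 p.2 := by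
  have hg := summable_geometric_of_lt_one (norm_nonneg _) hq
  have h0 := (LL_hasSum hq hq0 ha 0).summable.norm
  have hs := hg.mul_of_nonneg h0 (fun _ => by positivity) (fun _ => by positivity)
  refine Summable.of_norm_bounded hs fun p => ?_
  obtain ⟨r, k⟩ := p
  have hqp : 0 < ‖q‖ := norm_pos_iff.mpr hq0
  simp only [LL, mono, norm_mul, norm_zpow, norm_neg, norm_one, one_zpow, one_mul]
  have h1 : ‖q‖ ^ (5 * tri (r + 1) + |k| * r + tri (|k| + 1)) ≤
      ‖q‖ ^ ((r : ℤ) + (5 * tri ((0 : ℕ) + 1) + |k| * (0 : ℕ) + tri (|k| + 1))) := by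
    refine zpow_le_zpow_right_of_le_one₀ hqp hq.le ?_
    have h1 := two_tri (r + 1)
    have h2 : 0 ≤ |k| * r := by positivity
    have h3 : tri ((0 : ℕ) + 1) = 0 := by simp [tri]
    rw [h3]
    have h4 : (0 : ℤ) ≤ (r : ℤ) * r := by positivity
    have h5 : (0 : ℤ) ≤ (r : ℤ) := by positivity
    push_cast
    nlinarith
  rw [zpow_add₀ hqp.ne' (r : ℤ), zpow_natCast] at h1
  calc _ ≤ ‖a‖ ^ k * (‖q‖ ^ r * ‖q‖ ^ (5 * tri ((0 : ℕ) + 1) + |k| * (0 : ℕ) + tri (|k| + 1))) := by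
        gcongr
    _ = _ := by ring

noncomputable def FF (q a : ℂ) (n : ℕ) (N : ℤ) : ℂ :=
  mono q a (N - n) N (tri N + 5 * tri (n + 1) - N * n)

lemma quad_summable (hq : ‖q‖ < 1) (x : ℂ) (e : ℕ → ℕ) (he : ∀ n, n.choose 2 ≤ e n) :
    Summable fun n : ℕ => x ^ n * q ^ (e n) := by
  refine Summable.of_norm_bounded (summable_real_theta (norm_nonneg x) (norm_nonneg q) hq)
    fun n => ?_
  rw [norm_mul, norm_pow, norm_pow]
  have := pow_le_pow_of_le_one (norm_nonneg q) hq.le (he n)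
  gcongr

lemma choose_two_le (n : ℕ) : n.choose 2 ≤ n * n := by
  have := two_choose n
  zify
  nlinarith

lemma FF_eq (hq0 : q ≠ 0) (ha : a ≠ 0) (n : ℕ) (N : ℤ) :
    FF q a n N = a ^ n * q ^ (2 * n * (n + 1)) * mono q a (N - n) (N - n) (tri (N - n)) := by
  have e : mono q a 0 n ((2 * n * (n + 1) : ℕ) : ℤ) = a ^ n * q ^ (2 * n * (n + 1)) := by
    simp only [mono, zpow_natCast, zpow_zero, one_mul]
  have h5 := two_tri N
  have h6 := two_tri (N - n)
  have h7 := two_tri (n + 1)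
  rw [← e, mono_mul hq0 ha, FF]
  refine mono_congr ⟨0, by ring⟩ (by ring) ?_
  push_cast
  linarith

lemma R1_summable (hq : ‖q‖ < 1) : Summable fun n : ℕ => a ^ n * q ^ (2 * n * (n + 1)) :=
  quad_summable hq a (fun n => 2 * n * (n + 1)) fun n => (choose_two_le n).trans (by
      change n * n ≤ 2 * n * (n + 1)
      nlinarith)

lemma FF_hasSum (hq : ‖q‖ < 1) (hq0 : q ≠ 0) (ha : a ≠ 0) :
    HasSum (fun p : ℕ × ℤ => FF q a p.1 p.2)
      ((∑' n : ℕ, a ^ n * q ^ (2 * n * (n + 1))) *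
        (qPochInf q q * qPochInf a q * qPochInf (q / a) q)) := by
  have h1 := R1_summable (a := a) hq
  have h2 := theta_int hq hq0 ha
  have h3 : HasSum (fun x : ℕ × ℤ => (a ^ x.1 * q ^ (2 * x.1 * (x.1 + 1))) *
      mono q a x.2 x.2 (tri x.2)) ((∑' n : ℕ, a ^ n * q ^ (2 * n * (n + 1))) *
        (qPochInf q q * qPochInf a q * qPochInf (q / a) q)) :=
    HasSum.mul (f := fun n : ℕ => a ^ n * q ^ (2 * n * (n + 1)))
      (g := fun k : ℤ => mono q a k k (tri k)) h1.hasSum h2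
      (summable_mul_of_summable_norm (f := fun n : ℕ => a ^ n * q ^ (2 * n * (n + 1)))
      (g := fun k : ℤ => mono q a k k (tri k)) h1.norm h2.summable.norm)
  generalize (∑' n : ℕ, a ^ n * q ^ (2 * n * (n + 1))) *
        (qPochInf q q * qPochInf a q * qPochInf (q / a) q) = Y at h3 ⊢
  have h5 : (fun p : ℕ × ℤ => FF q a p.1 p.2) =
    (fun x : ℕ × ℤ => (a ^ x.1 * q ^ (2 * x.1 * (x.1 + 1))) *
      mono q a x.2 x.2 (tri x.2)) ∘ (Equiv.prodShear (Equiv.refl ℕ)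
    (fun n : ℕ => Equiv.subRight (n : ℤ))) := by
    funext p
    rw [FF_eq hq0 ha]
    simp only [Function.comp, Equiv.prodShear_apply, Equiv.refl_apply, Equiv.subRight_apply]
  rw [h5, Equiv.hasSum_iff]
  exact h3

noncomputable def JJ (q : ℂ) (i : ℕ) : ℂ :=
  qPochInf (q ^ i) (q ^ 5) * qPochInf (q ^ (5 - i)) (q ^ 5) * qPochInf (q ^ 5) (q ^ 5)

noncomputable def phi (q a : ℂ) (N n : ℤ) : ℂ :=
  mono q a (N + n) N (tri N + 5 * tri (n + 1) - N * n)

lemma phi_hasSum (hq : ‖q‖ < 1) (hq0 : q ≠ 0) (ha : a ≠ 0) (m i : ℕ) (hi : i ≤ 5) :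
    HasSum (phi q a (5 * m + i : ℕ))
      ((-1) ^ i * a ^ i * q ^ (i.choose 2) * JJ q i *
        (a ^ (5 * m) * q ^ (2 * m * (5 * m + 2 * i)))) := by
  have hq5 : ‖q ^ 5‖ < 1 := by
    rw [norm_pow]; exact pow_lt_one₀ (norm_nonneg _) hq (by norm_num)
  have h1 := theta_int hq5 (pow_ne_zero 5 hq0) (pow_ne_zero (5 - i) hq0)
  have e1 : q ^ 5 / q ^ (5 - i) = q ^ i := by
    have : q ^ 5 = q ^ i * q ^ (5 - i) := by rw [← pow_add]; congr 1; omega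
    rw [this]
    field_simp
  rw [e1] at h1
  have h2 := h1.mul_left ((-1) ^ i * a ^ i * q ^ (i.choose 2) *
    (a ^ (5 * m) * q ^ (2 * m * (5 * m + 2 * i))))
  rw [← (Equiv.subRight (m : ℤ)).hasSum_iff] at h2
  have e2 : (-1) ^ i * a ^ i * q ^ (i.choose 2) * JJ q i *
        (a ^ (5 * m) * q ^ (2 * m * (5 * m + 2 * i))) =
      ((-1) ^ i * a ^ i * q ^ (i.choose 2) *
    (a ^ (5 * m) * q ^ (2 * m * (5 * m + 2 * i)))) *
      (qPochInf (q ^ 5) (q ^ 5) * qPochInf (q ^ (5 - i)) (q ^ 5) * qPochInf (q ^ i) (q ^ 5)) := by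
    rw [JJ]; ring
  rw [e2]
  refine hasSum_cg ?_ h2
  intro n
  simp only [Function.comp, Equiv.subRight_apply, phi]
  have e3 : (-1) ^ i * a ^ i * q ^ (i.choose 2) *
    (a ^ (5 * m) * q ^ (2 * m * (5 * m + 2 * i))) =
      mono q a i (i + 5 * m : ℕ) (i.choose 2 + 2 * m * (5 * m + 2 * i) : ℕ) := by
    rw [mono_nat, pow_add, pow_add]; ring
  have e4 : mono (q ^ 5) (q ^ (5 - i)) (n - m) (n - m) (tri (n - m)) =
      mono q a (n - m) 0 ((5 - i) * (n - m) + 5 * tri (n - m)) := by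
    rw [mono, mono, zpow_add₀ hq0, zpow_mul, zpow_mul]
    have : ((5 : ℤ) - i) = ((5 - i : ℕ) : ℤ) := by omega
    rw [this, zpow_natCast]
    norm_cast
    simp
    ring
  rw [e3, e4, mono_mul hq0 ha]
  refine mono_congr ⟨3 * m, by push_cast; ring⟩ (by push_cast; ring) ?_
  have h1 := two_tri (5 * m + i : ℕ)
  have h2 := two_tri (n - m)
  have h3 := two_tri (n + 1)
  have h4 := two_choose i
  push_cast at *
  linarith

noncomputable def DD (q a : ℂ) (N : ℤ) : ℂ :=
  if 0 ≤ N then - ∑' n : ℤ, phi q a N n else 0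

lemma LF_hasSum (hq : ‖q‖ < 1) (hq0 : q ≠ 0) (ha : a ≠ 0) (N : ℤ) :
    HasSum (fun r : ℕ => LL q a r N - FF q a r N) (DD q a N) := by
  by_cases hN : 0 ≤ N
  · rw [DD, if_pos hN]
    obtain ⟨M, rfl⟩ := Int.eq_ofNat_of_zero_le hN
    have hs : Summable (phi q a M) := by
      have := (phi_hasSum hq hq0 ha (M / 5) (M % 5) (by omega)).summable
      rwa [Nat.div_add_mod] at this
    refine hasSum_cg ?_ hs.hasSum.nat_add_neg_add_one.neg
    intro r
    have e1 : FF q a r M = phi q a M r := by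
      rw [FF, phi]
      exact mono_congr ⟨-r, by ring⟩ rfl rfl
    have e2 : LL q a r M = - phi q a M (-(r + 1)) := by
      have : phi q a M (-(r + 1)) = mono q a (-1) 0 0 * LL q a r M := by
        rw [phi, LL, mono_mul hq0 ha]
        refine mono_congr ⟨-r, by ring⟩ (by ring) ?_
        have h1 := two_tri M
        have h2 := two_tri (-(r + 1) + 1)
        have h3 := two_tri (r + 1)
        have h4 := two_tri (M + 1)
        rw [Nat.abs_cast]
        linarith
      rw [this]
      simp [mono]
    rw [e1, e2]
    ring
  · rw [DD, if_neg hN]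
    refine hasSum_cg ?_ hasSum_zero
    intro r
    rw [sub_eq_zero, LL, FF]
    refine mono_congr ⟨r, by ring⟩ rfl ?_
    rw [abs_of_neg (by omega)]
    have h1 := two_tri N
    have h3 := two_tri (r + 1)
    have h4 := two_tri (-N + 1)
    linarith

lemma DD_val (hq : ‖q‖ < 1) (hq0 : q ≠ 0) (ha : a ≠ 0) (m i : ℕ) (hi : i ≤ 5) :
    DD q a (5 * m + i : ℕ) = -((-1) ^ i * a ^ i * q ^ (i.choose 2) * JJ q i) *
        (a ^ (5 * m) * q ^ (2 * m * (5 * m + 2 * i))) := by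
  rw [DD, if_pos (by positivity), (phi_hasSum hq hq0 ha m i hi).tsum_eq]
  ring

lemma main_diff (hq : ‖q‖ < 1) (hq0 : q ≠ 0) (ha : a ≠ 0) :
    (∑' r : ℕ, ((-1) ^ r * q ^ (r.choose 2) * q ^ (r * (r + 1)) * q ^ (r * (r + 1)) * q ^ r) *
      (pth q (a * q ^ (r + 1)) + pth q (q / a * q ^ r) - 1)) -
    (∑' n : ℕ, a ^ n * q ^ (2 * n * (n + 1))) *
        (qPochInf q q * qPochInf a q * qPochInf (q / a) q) =
    ∑ i : Fin 5, -((-1) ^ (i : ℕ) * a ^ (i : ℕ) * q ^ ((i : ℕ).choose 2) * JJ q i) *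
      ∑' n : ℕ, a ^ (5 * n) * q ^ (2 * n * (5 * n + 2 * i)) := by
  have hL := (LL_summable hq hq0 ha).hasSum
  have hX := hL.prod_fiberwise (fun r => LL_hasSum hq hq0 ha r)
  rw [hX.tsum_eq]
  have hD := hL.sub (FF_hasSum hq hq0 ha)
  rw [← (Equiv.prodComm ℤ ℕ).hasSum_iff] at hD
  have hZ := hD.prod_fiberwise (fun N => LF_hasSum hq hq0 ha N)
  rw [← Function.Injective.hasSum_iff (g := ((↑) : ℕ → ℤ)) Nat.cast_injective (by
    intro x hx
    rw [DD, if_neg]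
    intro h
    exact hx ⟨x.toNat, Int.toNat_of_nonneg h⟩)] at hZ
  rw [← (Nat.divModEquiv 5).symm.hasSum_iff] at hZ
  have hM := hZ.prod_fiberwise (fun m => hasSum_fintype _)
  refine hM.unique ?_
  have : HasSum (fun m : ℕ => ∑ i : Fin 5,
      -((-1) ^ (i : ℕ) * a ^ (i : ℕ) * q ^ ((i : ℕ).choose 2) * JJ q i) *
        (a ^ (5 * m) * q ^ (2 * m * (5 * m + 2 * i))))
      (∑ i : Fin 5, -((-1) ^ (i : ℕ) * a ^ (i : ℕ) * q ^ ((i : ℕ).choose 2) * JJ q i) *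
      ∑' n : ℕ, a ^ (5 * n) * q ^ (2 * n * (5 * n + 2 * i))) := by
    refine hasSum_sum fun i _ => HasSum.mul_left _ ?_
    refine Summable.hasSum ?_
    simp only [pow_mul a]
    refine quad_summable hq _ _ fun n => (choose_two_le n).trans ?_
    nlinarith [Nat.zero_le (n * n), Nat.zero_le (n * i)]
  refine hasSum_cg ?_ this
  intro m
  refine Finset.sum_congr rfl fun i _ => ?_
  rw [← DD_val hq hq0 ha m i (by omega)]
  simp [Nat.divModEquiv, mul_comm]

theorem main (hq : ‖q‖ < 1) (hq0 : q ≠ 0) (ha : a ≠ 0) (ha' : ∀ n : ℤ, a ≠ q ^ n) :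
    ∑' n : ℕ, (qPoch (q ^ (n + 1)) q n * q ^ n / (qPoch a q (n + 1) * qPoch (q / a) q n)) *
        ∑ r ∈ Finset.range (n + 1), q ^ (r * (r + 1)) * qbinom q n r
      = (∑' n : ℕ, a ^ n * q ^ (2 * n * (n + 1)))
        + ∑ i ∈ Finset.range 4,
            (-1 : ℂ) ^ (i + 2) * a ^ (i + 1) * q ^ ((i + 1) * i / 2) *
              (qPochInf (q ^ (i + 1)) (q ^ 5) * qPochInf (q ^ (4 - i)) (q ^ 5) *
                qPochInf (q ^ 5) (q ^ 5)) /
              (qPochInf q q * qPochInf a q * qPochInf (q / a) q) *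
              ∑' n : ℕ, a ^ (5 * n) * q ^ (2 * n * (5 * n + 2 * (i + 1))) := by
  have hT : qPochInf q q * qPochInf a q * qPochInf (q / a) q ≠ 0 :=
    mul_ne_zero (mul_ne_zero (poch_ne_zero hq (one_sub_ne hq)) (poch_ne_zero hq (ne1 hq0 ha')))
      (poch_ne_zero hq (ne2 hq0 ha ha'))
  have h1 := lhs_eq hq hq0 ha ha'
  have h2 := main_diff hq hq0 ha
  rw [← h1] at h2
  have hq5 : ‖q ^ 5‖ < 1 := by
    rw [norm_pow]; exact pow_lt_one₀ (norm_nonneg _) hq (by norm_num)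
  have hJ0 : JJ q 0 = 0 := by rw [JJ, pow_zero, poch_one hq5]; ring
  rw [Fin.sum_univ_eq_sum_range (fun i : ℕ => -((-1) ^ i * a ^ i * q ^ (i.choose 2) * JJ q i) *
      ∑' n : ℕ, a ^ (5 * n) * q ^ (2 * n * (5 * n + 2 * i))) 5, Finset.sum_range_succ', hJ0] at h2
  have h3 : ∑ i ∈ Finset.range 4,
            (-1 : ℂ) ^ (i + 2) * a ^ (i + 1) * q ^ ((i + 1) * i / 2) *
              (qPochInf (q ^ (i + 1)) (q ^ 5) * qPochInf (q ^ (4 - i)) (q ^ 5) *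
                qPochInf (q ^ 5) (q ^ 5)) /
              (qPochInf q q * qPochInf a q * qPochInf (q / a) q) *
              ∑' n : ℕ, a ^ (5 * n) * q ^ (2 * n * (5 * n + 2 * (i + 1))) =
      (∑ i ∈ Finset.range 4,
        -((-1) ^ (i + 1) * a ^ (i + 1) * q ^ ((i + 1).choose 2) * JJ q (i + 1)) *
      ∑' n : ℕ, a ^ (5 * n) * q ^ (2 * n * (5 * n + 2 * (i + 1)))) /
        (qPochInf q q * qPochInf a q * qPochInf (q / a) q) := by
    rw [Finset.sum_div]
    refine Finset.sum_congr rfl fun i _ => ?_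
    have e1 : 5 - (i + 1) = 4 - i := by omega
    rw [JJ, e1, Nat.choose_two_right, Nat.add_sub_cancel, pow_succ (-1 : ℂ) (i + 1)]
    ring
  rw [h3, ← sub_eq_iff_eq_add', eq_div_iff hT]
  linear_combination h2

end final


end PT

/-- The k = 2 case of Theorem 1. -/
theorem stmt_19 (q a : ℂ) (hq : ‖q‖ < 1) (hq0 : q ≠ 0) (ha : a ≠ 0)
    (ha' : ∀ n : ℤ, a ≠ q ^ n) :
    ∑' n : ℕ, (qPoch (q ^ (n + 1)) q n * q ^ n / (qPoch a q (n + 1) * qPoch (q / a) q n)) *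
        ∑ r ∈ Finset.range (n + 1), q ^ (r * (r + 1)) * qbinom q n r
      = (∑' n : ℕ, a ^ n * q ^ (2 * n * (n + 1)))
        + ∑ i ∈ Finset.range 4,
            (-1 : ℂ) ^ (i + 2) * a ^ (i + 1) * q ^ ((i + 1) * i / 2) *
              (qPochInf (q ^ (i + 1)) (q ^ 5) * qPochInf (q ^ (4 - i)) (q ^ 5) *
                qPochInf (q ^ 5) (q ^ 5)) /
              (qPochInf q q * qPochInf a q * qPochInf (q / a) q) *
              ∑' n : ℕ, a ^ (5 * n) * q ^ (2 * n * (5 * n + 2 * (i + 1))) := by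
  exact PT.main hq hq0 ha ha'
end
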